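/- arXiv:1302.4461 — 3 statements merged into one kernel-verified Lean document; each statement's English description precedes it below -/
import Mathlib

section
/- Let I be a Borel fixed monomial ideal in the multigraded polynomial ring S with minimal primes P_{b_1},...,P_{b_c}. Then the G-multidegree of S/I equals Σ_{i=1}^c length((S/I)_{P_{b_i}}) · y^{b_i}, where the length is that of the localization of S/I at the minimal prime P_{b_i}. -/
open MvPolynomial

/-- Variable index set for `S = K[x_{ij} : 1 ≤ i ≤ m, 1 ≤ j ≤ n_i]`. -/
abbrev MVar (m : ℕ) (n : Fin m → ℕ) := Σ i : Fin m, Fin (n i)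

/-- The multidegree in `ℕ^m` of a monomial exponent vector `d`, for the grading
`deg x_{ij} = e_i`. -/
def mdeg {m : ℕ} {n : Fin m → ℕ} (d : MVar m n →₀ ℕ) (i : Fin m) : ℕ := ∑ j, d ⟨i, j⟩

/-- The `K`-span of the monomials of multidegree `a`. -/
noncomputable def homogOfDeg (K : Type*) [Field K] {m : ℕ} (n : Fin m → ℕ)
    (a : Fin m → ℕ) : Submodule K (MvPolynomial (MVar m n) K) :=
  Submodule.span K {f | ∃ d : MVar m n →₀ ℕ, mdeg d = a ∧ f = monomial d (1 : K)}

/-- The degree-`a` graded piece of `S/I`, as a `K`-subspace of `S ⧸ I`. -/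
noncomputable def quotPiece {K : Type*} [Field K] {m : ℕ} {n : Fin m → ℕ}
    (I : Ideal (MvPolynomial (MVar m n) K)) (a : Fin m → ℕ) :
    Submodule K (MvPolynomial (MVar m n) K ⧸ I) :=
  Submodule.map (Ideal.Quotient.mkₐ K I).toLinearMap (homogOfDeg K n a)

/-- The multigraded Hilbert series of `S/I`, an element of `ℤ[[y_1,…,y_m]]`. -/
noncomputable def HSquot {K : Type*} [Field K] {m : ℕ} {n : Fin m → ℕ}
    (I : Ideal (MvPolynomial (MVar m n) K)) : MvPowerSeries (Fin m) ℤ :=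
  fun a => (Module.finrank K (quotPiece I (a : (Fin m →₀ ℕ)) : Submodule K _) : ℤ)

/-- `p` is the `K`-polynomial of `S/I`:
`p = ∏_i (1-y_i)^{n_i} · HS(S/I, y)` as a power series identity. -/
def IsKPolynomialOfQuot {K : Type*} [Field K] {m : ℕ} {n : Fin m → ℕ}
    (I : Ideal (MvPolynomial (MVar m n) K)) (p : MvPolynomial (Fin m) ℤ) : Prop :=
  (p : MvPowerSeries (Fin m) ℤ) =
    (∏ i, (1 - MvPowerSeries.X i) ^ (n i)) * HSquot I

/-- The substitution `y_i ↦ 1 - y_i`, turning the `K`-polynomial into `C(M,y)`. -/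
noncomputable def Cpoly {m : ℕ} (p : MvPolynomial (Fin m) ℤ) : MvPolynomial (Fin m) ℤ :=
  MvPolynomial.aeval (fun i => 1 - MvPolynomial.X i) p

/-- The G-multidegree: the sum of the terms of `c` whose exponents are minimal in
the support of `c` (with respect to the componentwise order). -/
noncomputable def Gmulti {m : ℕ} (c : MvPolynomial (Fin m) ℤ) : MvPolynomial (Fin m) ℤ :=
  ∑ a ∈ c.support.filter (fun a => ∀ b ∈ c.support, b ≤ a → b = a),
    monomial a (c.coeff a)


/-- The ring automorphism of `S` induced by a family of matrices
`g i ∈ GL_{n_i}(K)`, sending `x_{ij} ↦ Σ_k (g i)_{kj} x_{ik}`. -/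
noncomputable def borelAut {K : Type*} [Field K] {m : ℕ} {n : Fin m → ℕ}
    (g : ∀ i : Fin m, Matrix (Fin (n i)) (Fin (n i)) K) :
    MvPolynomial (MVar m n) K →+* MvPolynomial (MVar m n) K :=
  (MvPolynomial.aeval
    (fun p : MVar m n => ∑ k, MvPolynomial.C (g p.1 k p.2) * X (⟨p.1, k⟩ : MVar m n))).toRingHom

/-- An ideal `I ⊆ S` is Borel fixed if it is fixed by every element of the product
of the Borel subgroups of upper triangular invertible matrices acting blockwise. -/
def IsBorelFixed {K : Type*} [Field K] {m : ℕ} {n : Fin m → ℕ}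
    (I : Ideal (MvPolynomial (MVar m n) K)) : Prop :=
  ∀ g : ∀ i : Fin m, Matrix (Fin (n i)) (Fin (n i)) K,
    (∀ i, (g i).BlockTriangular id) → (∀ i j, g i j j ≠ 0) →
      I.map (borelAut g) = I

/-- The prime `P_b = (x_{ij} : 1 ≤ j ≤ b_i)` generated by initial segments of
variables in each block. -/
noncomputable def Pb {K : Type*} [Field K] {m : ℕ} {n : Fin m → ℕ} (b : Fin m → ℕ) :
    Ideal (MvPolynomial (MVar m n) K) :=
  Ideal.span {f | ∃ (i : Fin m) (j : Fin (n i)), (j : ℕ) < b i ∧ f = X (⟨i, j⟩ : MVar m n)}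

/-- `I ⊆ S` is a monomial ideal if it is generated by monomials. -/
def IsMonomialIdeal {K : Type*} [Field K] {m : ℕ} {n : Fin m → ℕ}
    (I : Ideal (MvPolynomial (MVar m n) K)) : Prop :=
  ∃ T : Set (MVar m n →₀ ℕ), I = Ideal.span ((fun d => (monomial d (1 : K))) '' T)

section LocalizedLength

variable {R : Type*} [CommRing R]

/-- The length of the localization of `R ⧸ J` at the prime `P`. -/
noncomputable def locLength (P : Ideal R) [P.IsPrime] (J : Ideal R) : ℕ∞ :=
  Module.length (Localization.AtPrime P) (LocalizedModule P.primeCompl (R ⧸ J))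

lemma locLength_eq_zero {P J : Ideal R} [P.IsPrime] (h : ¬ J ≤ P) : locLength P J = 0 := by
  obtain ⟨r, hrJ, hrP⟩ := SetLike.not_le_iff_exists.1 h
  rw [locLength, Module.length_eq_zero_iff, LocalizedModule.subsingleton_iff]
  intro z
  obtain ⟨f, rfl⟩ := Ideal.Quotient.mk_surjective z
  refine ⟨r, hrP, ?_⟩
  rw [Algebra.smul_def, Ideal.Quotient.algebraMap_eq, ← map_mul, Ideal.Quotient.eq_zero_iff_mem]
  exact J.mul_mem_right f hrJ

lemma locLength_pos {P J : Ideal R} [P.IsPrime] (h : J ≤ P) : 0 < locLength P J := by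
  rw [locLength, Module.length_pos_iff, ← not_subsingleton_iff_nontrivial,
    LocalizedModule.subsingleton_iff]
  intro H
  obtain ⟨r, hr, hr0⟩ := H 1
  rw [Algebra.smul_def, mul_one, Ideal.Quotient.algebraMap_eq,
    Ideal.Quotient.eq_zero_iff_mem] at hr0
  exact hr (h hr0)

lemma locLength_self (P : Ideal R) [P.IsPrime] : locLength P P = 1 := by
  rw [locLength, Module.length_eq_one_iff, isSimpleModule_iff_toSpanSingleton_surjective]
  refine ⟨Module.length_pos_iff.1 (locLength_pos le_rfl), fun v hv w => ?_⟩
  induction v using LocalizedModule.induction_on with | h v s =>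
  induction w using LocalizedModule.induction_on with | h w t =>
  obtain ⟨f, rfl⟩ := Ideal.Quotient.mk_surjective v
  obtain ⟨g, rfl⟩ := Ideal.Quotient.mk_surjective w
  have hf : f ∈ P.primeCompl := by
    intro hf
    refine hv ?_
    rw [Ideal.Quotient.eq_zero_iff_mem.2 hf, LocalizedModule.zero_mk]
  refine ⟨Localization.mk (g * s) (⟨f, hf⟩ * t), ?_⟩
  rw [LinearMap.toSpanSingleton_apply, LocalizedModule.mk_smul_mk, LocalizedModule.mk_eq]
  refine ⟨1, ?_⟩
  simp only [Submonoid.smul_def, Algebra.smul_def, Ideal.Quotient.algebraMap_eq, ← map_mul,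
    Submonoid.coe_mul, Submonoid.coe_one]
  congr 1
  ring

/-- The colon ideal `J : x`. -/
def colonElem (J : Ideal R) (x : R) : Ideal R :=
  Submodule.comap (LinearMap.mulLeft R x) J

lemma mem_colonElem {J : Ideal R} {x f : R} : f ∈ colonElem J x ↔ x * f ∈ J := Iff.rfl

lemma le_colonElem (J : Ideal R) (x : R) : J ≤ colonElem J x := fun _ hf => J.mul_mem_left x hf

lemma locLength_eq_add (P : Ideal R) [P.IsPrime] (J : Ideal R) (x : R) :
    locLength P J = locLength P (colonElem J x) + locLength P (J ⊔ Ideal.span {x}) := by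
  let f : (R ⧸ colonElem J x) →ₗ[R] R ⧸ J :=
    Submodule.mapQ (colonElem J x) J (LinearMap.mulLeft R x) le_rfl
  let g : (R ⧸ J) →ₗ[R] R ⧸ (J ⊔ Ideal.span {x}) :=
    Submodule.mapQ J (J ⊔ Ideal.span {x}) LinearMap.id le_sup_left
  have hf : Function.Injective f := by
    rw [← LinearMap.ker_eq_bot, LinearMap.ker_eq_bot']
    intro m hm
    obtain ⟨a, rfl⟩ := Submodule.Quotient.mk_surjective _ m
    exact (Submodule.Quotient.mk_eq_zero _).2 ((Submodule.Quotient.mk_eq_zero J).1 hm)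
  have hg : Function.Surjective g := by
    intro m
    obtain ⟨a, rfl⟩ := Submodule.Quotient.mk_surjective _ m
    exact ⟨Submodule.Quotient.mk a, rfl⟩
  have hfg : Function.Exact f g := by
    intro m
    obtain ⟨a, rfl⟩ := Submodule.Quotient.mk_surjective _ m
    constructor
    · intro h
      have h' : a ∈ J ⊔ Ideal.span {x} := (Submodule.Quotient.mk_eq_zero _).1 h
      obtain ⟨j, hj, y, hy, rfl⟩ := Submodule.mem_sup.1 h'
      obtain ⟨r, rfl⟩ := Ideal.mem_span_singleton.1 hy
      refine ⟨Submodule.Quotient.mk r, ?_⟩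
      refine (Submodule.Quotient.eq J).2 ?_
      simpa using hj
    · rintro ⟨r, hr⟩
      obtain ⟨r, rfl⟩ := Submodule.Quotient.mk_surjective _ r
      rw [← hr]
      refine (Submodule.Quotient.mk_eq_zero _).2 ?_
      exact le_sup_right (a := J) (Ideal.mul_mem_right r _ (Ideal.mem_span_singleton_self x))
  exact Module.length_eq_add_of_exact (LocalizedModule.map P.primeCompl f)
    (LocalizedModule.map P.primeCompl g) (LocalizedModule.map_injective _ f hf)
    (LocalizedModule.map_surjective _ g hg) (LocalizedModule.map_exact _ f g hfg)

end LocalizedLength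

section MonomialIdeal

variable {K σ : Type*} [Field K]

/-- An ideal is spanned by monomials if it contains every monomial in the support of each of
its elements. -/
def HasMonomialSupport (J : Ideal (MvPolynomial σ K)) : Prop :=
  ∀ f ∈ J, ∀ d ∈ f.support, monomial d (1 : K) ∈ J

lemma monomial_mem_of_le {J : Ideal (MvPolynomial σ K)} {d e : σ →₀ ℕ} (hde : d ≤ e)
    (hd : monomial d (1 : K) ∈ J) : monomial e (1 : K) ∈ J := by
  obtain ⟨t, rfl⟩ := exists_add_of_le hde
  have : monomial (d + t) (1 : K) = monomial d 1 * monomial t 1 := by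
    rw [monomial_mul, one_mul]
  rw [this]
  exact J.mul_mem_right _ hd

lemma HasMonomialSupport.le_iff {J L : Ideal (MvPolynomial σ K)} (hJ : HasMonomialSupport J) :
    J ≤ L ↔ ∀ d, monomial d (1 : K) ∈ J → monomial d (1 : K) ∈ L := by
  refine ⟨fun h d hd => h hd, fun h f hf => ?_⟩
  rw [f.as_sum]
  refine L.sum_mem fun d hd => ?_
  have : monomial d (coeff d f) = C (coeff d f) * monomial d (1 : K) := by
    rw [C_mul_monomial, mul_one]
  rw [this]
  exact L.mul_mem_left _ (h d (hJ f hf d hd))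

lemma X_mul_monomial (x : σ) (d : σ →₀ ℕ) :
    X x * monomial d (1 : K) = monomial (Finsupp.single x 1 + d) 1 := by
  rw [X, monomial_mul, one_mul]

lemma HasMonomialSupport.colonElem {J : Ideal (MvPolynomial σ K)} (hJ : HasMonomialSupport J)
    (x : σ) : HasMonomialSupport (colonElem J (X x)) := by
  intro f hf d hd
  rw [mem_colonElem, X_mul_monomial]
  refine hJ (X x * f) hf _ ?_
  rw [mem_support_iff, coeff_X_mul]
  exact mem_support_iff.1 hd

lemma HasMonomialSupport.mem_or_of_mem_sup {J : Ideal (MvPolynomial σ K)}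
    (hJ : HasMonomialSupport J) {x : σ} {f : MvPolynomial σ K} (hf : f ∈ J ⊔ Ideal.span {X x})
    {d : σ →₀ ℕ} (hd : d ∈ f.support) : monomial d (1 : K) ∈ J ∨ d x ≠ 0 := by
  classical
  obtain ⟨j, hj, y, hy, rfl⟩ := Submodule.mem_sup.1 hf
  obtain ⟨r, rfl⟩ := Ideal.mem_span_singleton.1 hy
  rcases Finset.mem_union.1 (support_add hd) with h | h
  · exact Or.inl (hJ j hj d h)
  · right
    rw [mem_support_iff, coeff_X_mul'] at h
    intro h0
    exact h (if_neg (by simpa using h0))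

lemma monomial_mem_span_X {x : σ} {d : σ →₀ ℕ} (hd : d x ≠ 0) :
    monomial d (1 : K) ∈ Ideal.span {(X x : MvPolynomial σ K)} := by
  refine monomial_mem_of_le (d := Finsupp.single x 1) ?_ (Ideal.mem_span_singleton_self _)
  simpa [Nat.one_le_iff_ne_zero] using hd

lemma HasMonomialSupport.monomial_mem_sup_iff {J : Ideal (MvPolynomial σ K)}
    (hJ : HasMonomialSupport J) {x : σ} {d : σ →₀ ℕ} :
    monomial d (1 : K) ∈ J ⊔ Ideal.span {X x} ↔ monomial d (1 : K) ∈ J ∨ d x ≠ 0 := by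
  classical
  refine ⟨fun h => hJ.mem_or_of_mem_sup h ?_, ?_⟩
  · rw [mem_support_iff, coeff_monomial, if_pos rfl]
    exact one_ne_zero
  rintro (h | h)
  · exact le_sup_left (a := J) h
  · exact le_sup_right (a := J) (monomial_mem_span_X h)

lemma HasMonomialSupport.sup_span_X {J : Ideal (MvPolynomial σ K)} (hJ : HasMonomialSupport J)
    (x : σ) : HasMonomialSupport (J ⊔ Ideal.span {X x}) := fun _ hf _ hd =>
  hJ.monomial_mem_sup_iff.2 (hJ.mem_or_of_mem_sup hf hd)

lemma monomial_mem_span_X_image {A : Set σ} {d : σ →₀ ℕ} :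
    monomial d (1 : K) ∈ Ideal.span (X '' A : Set (MvPolynomial σ K)) ↔ ∃ i ∈ A, d i ≠ 0 := by
  classical
  rw [mem_ideal_span_X_image, support_monomial, if_neg one_ne_zero]
  simp

lemma hasMonomialSupport_span_X_image (A : Set σ) :
    HasMonomialSupport (Ideal.span (X '' A : Set (MvPolynomial σ K))) := fun _ hf d hd =>
  monomial_mem_span_X_image.2 (mem_ideal_span_X_image.1 hf d hd)

lemma hasMonomialSupport_span_monomial (T : Set (σ →₀ ℕ)) :
    HasMonomialSupport (Ideal.span ((fun d => monomial d (1 : K)) '' T)) := by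
  classical
  intro f hf d hd
  rw [mem_ideal_span_monomial_image] at hf ⊢
  rw [support_monomial, if_neg one_ne_zero]
  simpa using hf d hd

lemma X_mem_span_X_image {A : Set σ} {x : σ} :
    (X x : MvPolynomial σ K) ∈ Ideal.span (X '' A : Set (MvPolynomial σ K)) ↔ x ∈ A := by
  classical
  rw [X, monomial_mem_span_X_image]
  simp [Finsupp.single_apply]

lemma span_X_image_le_iff {A B : Set σ} :
    Ideal.span (X '' A : Set (MvPolynomial σ K)) ≤ Ideal.span (X '' B) ↔ A ⊆ B := by
  refine ⟨fun h x hx => X_mem_span_X_image.1 (h (X_mem_span_X_image.2 hx)), fun h => ?_⟩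
  exact Ideal.span_mono (Set.image_mono h)

instance isPrime_span_X_image (A : Set σ) :
    (Ideal.span (X '' A : Set (MvPolynomial σ K))).IsPrime := by
  classical
  let φ : MvPolynomial σ K →ₐ[K] MvPolynomial σ K := aeval fun i => if i ∈ A then 0 else X i
  have hφ : Ideal.span (X '' A : Set (MvPolynomial σ K)) = RingHom.ker φ := by
    apply le_antisymm
    · rw [Ideal.span_le]
      rintro _ ⟨i, hi, rfl⟩
      simp [φ, hi]
    · intro f hf
      have : (Ideal.Quotient.mkₐ K (Ideal.span (X '' A : Set (MvPolynomial σ K)))).comp φ =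
          Ideal.Quotient.mkₐ K _ := by
        ext i
        by_cases hi : i ∈ A
        · have := Ideal.Quotient.eq_zero_iff_mem.2 (X_mem_span_X_image (K := K).2 hi)
          simp [φ, hi, this]
        · simp [φ, hi]
      have h := DFunLike.congr_fun this f
      rw [AlgHom.comp_apply, (RingHom.mem_ker.1 hf : φ f = 0), map_zero] at h
      exact Ideal.Quotient.eq_zero_iff_mem.1 h.symm
  rw [hφ]
  exact RingHom.ker_isPrime _

/-- Induction on monomial ideals via the colon and the sum with a variable. -/
@[elab_as_elim]
lemma HasMonomialSupport.induction [Finite σ] {motive : Ideal (MvPolynomial σ K) → Prop}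
    (top : motive ⊤) (span_X : ∀ A : Set σ, motive (Ideal.span (X '' A)))
    (step : ∀ J x, HasMonomialSupport J → motive (_root_.colonElem J (X x)) →
      motive (J ⊔ Ideal.span {X x}) → motive J)
    (J : Ideal (MvPolynomial σ K)) (hJ : HasMonomialSupport J) : motive J := by
  induction J using IsWellFounded.induction (· > · : Ideal (MvPolynomial σ K) → _ → Prop) with
  | ind J ih =>
  by_cases htop : J = ⊤
  · exact htop ▸ top
  let A : Set σ := {x | X x ∈ J}
  have hA : Ideal.span (X '' A) ≤ J := by
    rw [Ideal.span_le]
    rintro _ ⟨x, hx, rfl⟩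
    exact hx
  by_cases hJA : J ≤ Ideal.span (X '' A)
  · exact (le_antisymm hJA hA) ▸ span_X A
  have hne : {d | monomial d (1 : K) ∈ J ∧
      monomial d (1 : K) ∉ Ideal.span (X '' A : Set (MvPolynomial σ K))}.Nonempty := by
    by_contra h
    refine hJA (hJ.le_iff.2 fun d hd => ?_)
    by_contra hd'
    exact h ⟨d, hd, hd'⟩
  obtain ⟨d, ⟨hdJ, hdA⟩, hmin⟩ := WellFounded.has_min (r := (· < · : (σ →₀ ℕ) → _ → Prop))
    wellFounded_lt _ hne
  have hd0 : d ≠ 0 := by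
    rintro rfl
    exact htop ((Ideal.eq_top_iff_one J).2 hdJ)
  obtain ⟨x, hx⟩ := Finsupp.ne_iff.1 hd0
  have hx : d x ≠ 0 := hx
  have hxA : X x ∉ J := fun h => hdA (monomial_mem_span_X_image.2 ⟨x, h, hx⟩)
  obtain ⟨e, rfl⟩ := exists_add_of_le (a := Finsupp.single x 1) (b := d)
    (by simpa [Nat.one_le_iff_ne_zero] using hx)
  have heJ : monomial e (1 : K) ∉ J := by
    intro he
    refine hmin e ⟨he, fun h => hdA (monomial_mem_of_le (self_le_add_left _ _) h)⟩ ?_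
    exact lt_add_of_pos_left _ (pos_iff_ne_zero.2 (by simp))
  refine step J x hJ (ih _ ?_ (hJ.colonElem x)) (ih _ ?_ (hJ.sup_span_X x))
  · refine lt_of_le_not_ge (le_colonElem J _) fun h => heJ (h ?_)
    rwa [mem_colonElem, X_mul_monomial]
  · exact lt_of_le_not_ge le_sup_left fun h =>
      hxA (h (le_sup_right (a := J) (Ideal.mem_span_singleton_self _)))

end MonomialIdeal

section HilbertSeries

variable {K : Type*} [Field K] {m : ℕ} {n : Fin m → ℕ}

lemma mdeg_add (d e : MVar m n →₀ ℕ) : mdeg (d + e) = mdeg d + mdeg e := by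
  funext i
  simp [mdeg, Finset.sum_add_distrib]

lemma mdeg_single (x : MVar m n) : mdeg (Finsupp.single x 1) = ⇑(Finsupp.single x.1 1) := by
  classical
  obtain ⟨i, j⟩ := x
  funext k
  by_cases h : i = k
  · subst h
    simp [mdeg, Finsupp.single_apply]
  · simp [mdeg, h]

/-- The exponents of multidegree `a` of the standard monomials of `J`. -/
def stdExponents (J : Ideal (MvPolynomial (MVar m n) K)) (a : Fin m → ℕ) :
    Set (MVar m n →₀ ℕ) :=
  {d | mdeg d = a ∧ monomial d (1 : K) ∉ J}

lemma finite_stdExponents (J : Ideal (MvPolynomial (MVar m n) K)) (a : Fin m → ℕ) :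
    (stdExponents J a).Finite := by
  refine (Set.finite_Icc 0 (Finsupp.equivFunOnFinite.symm fun x : MVar m n => a x.1)).subset ?_
  rintro d ⟨rfl, -⟩
  refine ⟨zero_le, fun x => ?_⟩
  exact Finset.single_le_sum (f := fun j => d ⟨x.1, j⟩) (fun _ _ => Nat.zero_le _)
    (Finset.mem_univ x.2)

lemma finrank_quotPiece {J : Ideal (MvPolynomial (MVar m n) K)} (hJ : HasMonomialSupport J)
    (a : Fin m → ℕ) : Module.finrank K (quotPiece J a) = (stdExponents J a).ncard := by
  let v : stdExponents J a → MvPolynomial (MVar m n) K ⧸ J := fun d =>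
    Ideal.Quotient.mkₐ K J (monomial (d : MVar m n →₀ ℕ) 1)
  have hspan : quotPiece J a = Submodule.span K (Set.range v) := by
    rw [quotPiece, homogOfDeg, Submodule.map_span]
    apply le_antisymm
    · rw [Submodule.span_le]
      rintro _ ⟨_, ⟨d, hd, rfl⟩, rfl⟩
      by_cases hdJ : monomial d (1 : K) ∈ J
      · have : (Ideal.Quotient.mkₐ K J).toLinearMap (monomial d 1) = 0 :=
          Ideal.Quotient.eq_zero_iff_mem.2 hdJ
        rw [this]
        exact Submodule.zero_mem _
      · exact Submodule.subset_span ⟨⟨d, hd, hdJ⟩, rfl⟩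
    · refine Submodule.span_mono ?_
      rintro _ ⟨d, rfl⟩
      exact ⟨_, ⟨d, d.2.1, rfl⟩, rfl⟩
  have hv : LinearIndependent K v := by
    classical
    rw [linearIndependent_iff']
    intro s g hg d hd
    by_contra hgd
    have hmem : ∑ e ∈ s, monomial (e : MVar m n →₀ ℕ) (g e) ∈ J := by
      rw [← Ideal.Quotient.eq_zero_iff_mem, ← Ideal.Quotient.mkₐ_eq_mk K, map_sum, ← hg]
      refine Finset.sum_congr rfl fun e _ => ?_
      rw [← map_smul, smul_monomial, smul_eq_mul, mul_one]
    refine d.2.2 (hJ _ hmem d ?_)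
    rw [mem_support_iff, coeff_sum]
    simp only [coeff_monomial, Subtype.coe_inj]
    rw [Finset.sum_ite_eq' s d g, if_pos hd]
    exact hgd
  rw [hspan, Module.finrank, rank_span hv]
  exact Nat.card_congr (Equiv.ofInjective v hv.injective).symm

lemma coeff_HSquot {J : Ideal (MvPolynomial (MVar m n) K)} (hJ : HasMonomialSupport J)
    (a : Fin m →₀ ℕ) : MvPowerSeries.coeff a (HSquot J) = (stdExponents J a).ncard :=
  congrArg Nat.cast (finrank_quotPiece hJ a)

lemma stdExponents_top (a : Fin m → ℕ) :
    stdExponents (⊤ : Ideal (MvPolynomial (MVar m n) K)) a = ∅ := by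
  simp [stdExponents]

lemma HSquot_top : HSquot (⊤ : Ideal (MvPolynomial (MVar m n) K)) = 0 := by
  ext a
  rw [coeff_HSquot fun _ _ _ _ => Submodule.mem_top, stdExponents_top]
  simp

lemma HSquot_eq_add {J : Ideal (MvPolynomial (MVar m n) K)} (hJ : HasMonomialSupport J)
    (x : MVar m n) :
    HSquot J = HSquot (J ⊔ Ideal.span {X x}) +
      MvPowerSeries.X x.1 * HSquot (colonElem J (X x)) := by
  ext a
  rw [map_add, MvPowerSeries.X, MvPowerSeries.coeff_monomial_mul, coeff_HSquot hJ,
    coeff_HSquot (hJ.sup_span_X x), one_mul]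
  have hlow : stdExponents (J ⊔ Ideal.span {X x}) a = {d ∈ stdExponents J a | d x = 0} := by
    ext d
    simp only [stdExponents, Set.mem_ofPred_eq, hJ.monomial_mem_sup_iff]
    tauto
  split_ifs with ha
  · obtain ⟨a, rfl⟩ := exists_add_of_le ha
    rw [add_tsub_cancel_left, coeff_HSquot (hJ.colonElem x), ← Nat.cast_add, Nat.cast_inj]
    have hhigh : (fun d => Finsupp.single x 1 + d) '' stdExponents (colonElem J (X x)) a =
        {d ∈ stdExponents J (Finsupp.single x.1 1 + a : Fin m →₀ ℕ) | d x ≠ 0} := by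
      ext d
      constructor
      · rintro ⟨e, ⟨he, heJ⟩, rfl⟩
        rw [mem_colonElem, X_mul_monomial] at heJ
        refine ⟨⟨?_, heJ⟩, by simp⟩
        rw [mdeg_add, mdeg_single, he, Finsupp.coe_add]
      · rintro ⟨⟨hd, hdJ⟩, hdx⟩
        obtain ⟨e, rfl⟩ := exists_add_of_le (a := Finsupp.single x 1) (b := d)
          (by simpa [Nat.one_le_iff_ne_zero] using hdx)
        rw [mdeg_add, mdeg_single, Finsupp.coe_add] at hd
        refine ⟨e, ⟨add_left_cancel hd, ?_⟩, rfl⟩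
        rwa [mem_colonElem, X_mul_monomial]
    rw [hlow, ← Set.ncard_image_of_injective (stdExponents (colonElem J (X x)) a)
      (add_right_injective (Finsupp.single x 1)), hhigh]
    have hfin := finite_stdExponents J (Finsupp.single x.1 1 + a : Fin m →₀ ℕ)
    rw [← Set.ncard_union_eq _ (hfin.subset (Set.sep_subset _ _))
      (hfin.subset (Set.sep_subset _ _))]
    · congr 1
      ext d
      simp only [Set.mem_union, Set.mem_sep_iff]
      tauto
    · exact Set.disjoint_left.2 fun d h h' => h'.2 h.2
  · rw [add_zero, hlow, Nat.cast_inj]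
    congr 1
    refine (Set.sep_eq_self_iff_mem_true.2 fun d hd => ?_).symm
    by_contra hdx
    refine ha fun i => ?_
    obtain ⟨e, rfl⟩ := exists_add_of_le (a := Finsupp.single x 1) (b := d)
      (by simpa [Nat.one_le_iff_ne_zero] using hdx)
    rw [← hd.1, mdeg_add, mdeg_single]
    exact Nat.le_add_right _ _

/-- The number of elements of `A` in each block of variables. -/
noncomputable def blockCard (A : Set (MVar m n)) : Fin m →₀ ℕ :=
  Finsupp.equivFunOnFinite.symm fun i => {j | (⟨i, j⟩ : MVar m n) ∈ A}.ncard

lemma blockCard_apply (A : Set (MVar m n)) (i : Fin m) :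
    blockCard A i = {j | (⟨i, j⟩ : MVar m n) ∈ A}.ncard := rfl

lemma blockCard_mono {A B : Set (MVar m n)} (h : A ⊆ B) : blockCard A ≤ blockCard B := fun _ =>
  Set.ncard_le_ncard (fun _ hj => h hj)

lemma eq_of_subset_of_blockCard_le {A B : Set (MVar m n)} (h : A ⊆ B)
    (hcard : blockCard B ≤ blockCard A) : A = B := by
  refine h.antisymm ?_
  rintro ⟨i, j⟩ hj
  have : {j | (⟨i, j⟩ : MVar m n) ∈ A} = {j | (⟨i, j⟩ : MVar m n) ∈ B} :=
    Set.eq_of_subset_of_ncard_le (fun _ hj => h hj) (hcard i)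
  exact this.ge hj

lemma blockCard_insert {A : Set (MVar m n)} {x : MVar m n} (hx : x ∉ A) :
    blockCard (insert x A) = Finsupp.single x.1 1 + blockCard A := by
  obtain ⟨i, j⟩ := x
  ext k
  rw [Finsupp.add_apply, blockCard_apply, blockCard_apply]
  by_cases hk : i = k
  · subst hk
    have : {j' | (⟨i, j'⟩ : MVar m n) ∈ insert ⟨i, j⟩ A} =
        insert j {j' | (⟨i, j'⟩ : MVar m n) ∈ A} := by
      ext j'
      simp
    rw [this, Set.ncard_insert_of_notMem (by exact hx), Finsupp.single_eq_same, add_comm]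
  · rw [Finsupp.single_eq_of_ne (Ne.symm hk), zero_add]
    congr 1
    ext j'
    simp [Ne.symm hk]

lemma stdExponents_span_X_univ (a : Fin m → ℕ) :
    stdExponents (Ideal.span (X '' (Set.univ : Set (MVar m n))) : Ideal (MvPolynomial _ K)) a =
      {d | d = 0 ∧ a = 0} := by
  ext d
  simp only [stdExponents, monomial_mem_span_X_image, Set.mem_ofPred_eq, Set.mem_univ, true_and,
    not_exists, not_not]
  constructor
  · rintro ⟨rfl, h⟩
    have : d = 0 := Finsupp.ext h
    subst this
    exact ⟨rfl, by funext i; simp [mdeg]⟩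
  · rintro ⟨rfl, rfl⟩
    exact ⟨by funext i; simp [mdeg], fun _ => rfl⟩

lemma HSquot_span_X_univ :
    HSquot (Ideal.span (X '' (Set.univ : Set (MVar m n))) : Ideal (MvPolynomial _ K)) = 1 := by
  classical
  ext a
  rw [coeff_HSquot (hasMonomialSupport_span_X_image _), stdExponents_span_X_univ,
    MvPowerSeries.coeff_one]
  split_ifs with h
  · subst h
    simp
  · simp [h]

lemma blockCard_univ (i : Fin m) : blockCard (Set.univ : Set (MVar m n)) i = n i := by
  rw [blockCard_apply]
  simp

lemma isKPolynomialOfQuot_span_X (A : Set (MVar m n)) :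
    (∏ i, (1 - MvPowerSeries.X i) ^ (n i)) *
        HSquot (Ideal.span (X '' A) : Ideal (MvPolynomial _ K)) =
      ∏ i, (1 - MvPowerSeries.X i) ^ (blockCard A i) := by
  induction A using IsWellFounded.induction (· > · : Set (MVar m n) → _ → Prop) with
  | ind A ih =>
  by_cases hA : A = Set.univ
  · subst hA
    rw [HSquot_span_X_univ, mul_one]
    simp_rw [blockCard_univ]
  obtain ⟨x, hx⟩ := (Set.ne_univ_iff_exists_notMem A).1 hA
  have hcolon : colonElem (Ideal.span (X '' A) : Ideal (MvPolynomial _ K)) (X x) =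
      Ideal.span (X '' A) := by
    refine le_antisymm (fun f hf => ?_) (le_colonElem _ _)
    exact ((isPrime_span_X_image A).mem_or_mem hf).resolve_left fun h =>
      hx (X_mem_span_X_image.1 h)
  have hsup : (Ideal.span (X '' A) : Ideal (MvPolynomial _ K)) ⊔ Ideal.span {X x} =
      Ideal.span (X '' (insert x A)) := by
    rw [Set.image_insert_eq, Ideal.span_insert, sup_comm]
  have hrec := HSquot_eq_add (hasMonomialSupport_span_X_image (K := K) A) x
  rw [hcolon, hsup] at hrec
  have hne : (1 - MvPowerSeries.X x.1 : MvPowerSeries (Fin m) ℤ) ≠ 0 := by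
    intro h
    have := congrArg (MvPowerSeries.coeff 0) h
    simp at this
  have hins := ih (insert x A) (Set.ssubset_insert hx)
  have hpow : ∏ i, (1 - MvPowerSeries.X i : MvPowerSeries (Fin m) ℤ) ^ blockCard (insert x A) i =
      (1 - MvPowerSeries.X x.1) * ∏ i, (1 - MvPowerSeries.X i) ^ blockCard A i := by
    rw [blockCard_insert hx]
    simp only [Finsupp.add_apply, pow_add, Finset.prod_mul_distrib]
    congr 1
    rw [Finset.prod_eq_single x.1]
    · simp
    · intro i _ hi
      simp [hi]
    · simp
  apply mul_left_cancel₀ hne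
  rw [← hpow, ← hins, mul_left_comm]
  congr 1
  linear_combination hrec

end HilbertSeries

section Multidegree

variable {K : Type*} [Field K] {m : ℕ} {n : Fin m → ℕ}

/-- The set of variables generating `Pb b`. -/
def initialVars (b : Fin m → ℕ) : Set (MVar m n) := {x | (x.2 : ℕ) < b x.1}

lemma Pb_eq_span_X (b : Fin m → ℕ) :
    Pb (K := K) (n := n) b = Ideal.span (X '' initialVars b) := by
  rw [Pb]
  congr 1
  ext f
  constructor
  · rintro ⟨i, j, h, rfl⟩
    exact ⟨⟨i, j⟩, h, rfl⟩
  · rintro ⟨⟨i, j⟩, h, rfl⟩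
    exact ⟨i, j, h, rfl⟩

lemma initialVars_mono {b b' : Fin m → ℕ} (h : b ≤ b') :
    initialVars (n := n) b ⊆ initialVars b' := fun x hx => lt_of_lt_of_le hx (h x.1)

lemma blockCard_initialVars {b : Fin m → ℕ} (hb : ∀ k, b k ≤ n k) :
    blockCard (initialVars (n := n) b) = Finsupp.equivFunOnFinite.symm b := by
  ext i
  have : {j : Fin (n i) | (⟨i, j⟩ : MVar m n) ∈ initialVars b} =
      Set.range (Fin.castLE (hb i)) := by
    rw [Fin.range_castLE]
    rfl
  rw [blockCard_apply, this, ← Nat.card_coe_set_eq,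
    Nat.card_congr (Equiv.ofInjective _ (Fin.castLE_injective (hb i))).symm, Nat.card_fin]
  rfl

instance isPrime_Pb (b : Fin m → ℕ) : (Pb (K := K) (n := n) b).IsPrime :=
  Pb_eq_span_X (K := K) (n := n) b ▸ isPrime_span_X_image _

lemma coeff_one_sub_X_mul {c : MvPolynomial (Fin m) ℤ} {a : Fin m →₀ ℕ} (x : Fin m)
    (h : ∀ e ∈ c.support, e ≤ a → e = a) :
    coeff a ((1 - X x) * c) = coeff a c := by
  classical
  rw [sub_mul, one_mul, coeff_sub, coeff_X_mul', sub_eq_self]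
  split_ifs with hx
  · rw [← notMem_support_iff]
    intro hmem
    have := h _ hmem tsub_le_self
    have := DFunLike.congr_fun this x
    have hx : a x ≠ 0 := Finsupp.mem_support_iff.1 hx
    simp at this
    omega
  · rfl

lemma exists_le_of_mem_support_one_sub_X_mul {c : MvPolynomial (Fin m) ℤ} {a : Fin m →₀ ℕ}
    {x : Fin m} (h : a ∈ ((1 - X x) * c).support) : ∃ e ∈ c.support, e ≤ a := by
  classical
  rw [sub_mul, one_mul, mem_support_iff, coeff_sub, coeff_X_mul'] at h
  by_cases ha : a ∈ c.support
  · exact ⟨a, ha, le_rfl⟩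
  · rw [notMem_support_iff.1 ha, zero_sub, neg_ne_zero] at h
    split_ifs at h with hx
    · exact ⟨_, mem_support_iff.2 h, tsub_le_self⟩
    · exact absurd rfl h

/-- If `J` contains `I` and every prime over `I` contains one of the pairwise incomparable primes
`Pb (b i)`, then `S/J` has a `K`-polynomial, the support of `C(S/J, y)` lies above the `b i`, and
the coefficient of `y ^ b i` in `C(S/J, y)` is the length of `S/J` localized at `Pb (b i)`. -/
theorem exists_kPolynomial (I : Ideal (MvPolynomial (MVar m n) K)) {ι : Type*}
    (b : ι → Fin m → ℕ) (hbn : ∀ i k, b i k ≤ n k) (hb : ∀ i j, b i ≤ b j → i = j)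
    (hI : ∀ Q : Ideal (MvPolynomial (MVar m n) K), Q.IsPrime → I ≤ Q → ∃ i, Pb (b i) ≤ Q)
    (J : Ideal (MvPolynomial (MVar m n) K)) (hJ : HasMonomialSupport J) (hIJ : I ≤ J) :
    ∃ p : MvPolynomial (Fin m) ℤ, IsKPolynomialOfQuot J p ∧
      (∀ a ∈ (Cpoly p).support, ∃ i, Finsupp.equivFunOnFinite.symm (b i) ≤ a) ∧
      ∀ i, ∃ k : ℕ, locLength (Pb (b i)) J = k ∧
        coeff (Finsupp.equivFunOnFinite.symm (b i)) (Cpoly p) = k := by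
  classical
  revert hIJ
  refine HasMonomialSupport.induction ?_ (fun A hIJ => ?_) (fun J x hJ ih₁ ih₂ hIJ => ?_) J hJ
  · refine fun _ => ⟨0, ?_, by simp [Cpoly], fun i => ⟨0, ?_, by simp [Cpoly]⟩⟩
    · simp [IsKPolynomialOfQuot, HSquot_top]
    · exact locLength_eq_zero fun h => Ideal.IsPrime.ne_top inferInstance (top_le_iff.1 h)
  · obtain ⟨i₀, hi₀⟩ := hI _ (isPrime_span_X_image A) hIJ
    have hC : Cpoly (∏ i, (1 - X i) ^ blockCard A i) = monomial (blockCard A) (1 : ℤ) := by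
      rw [Cpoly, map_prod, monomial_eq, Finsupp.prod_fintype _ _ (by simp)]
      simp
    rw [Pb_eq_span_X, span_X_image_le_iff] at hi₀
    have hle := blockCard_mono hi₀
    rw [blockCard_initialVars (hbn _)] at hle
    refine ⟨∏ i, (1 - X i) ^ blockCard A i, ?_, ?_, fun i => ?_⟩
    · rw [IsKPolynomialOfQuot, isKPolynomialOfQuot_span_X, ← coeToMvPowerSeries.ringHom_apply,
        map_prod]
      simp_rw [map_pow, map_sub, map_one, coeToMvPowerSeries.ringHom_apply, MvPolynomial.coe_X]
    · rw [hC, support_monomial, if_neg one_ne_zero]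
      intro a ha
      exact ⟨i₀, (Finset.mem_singleton.1 ha) ▸ hle⟩
    · rw [hC, coeff_monomial]
      by_cases hA : A = initialVars (b i)
      · subst hA
        refine ⟨1, ?_, ?_⟩
        · rw [← Pb_eq_span_X, locLength_self, Nat.cast_one]
        · rw [blockCard_initialVars (hbn i), if_pos rfl, Nat.cast_one]
      · refine ⟨0, ?_, ?_⟩
        · rw [Nat.cast_zero]
          refine locLength_eq_zero ?_
          rw [Pb_eq_span_X, span_X_image_le_iff]
          intro h
          have hi : i₀ = i := by
            refine hb _ _ fun k => ?_
            have := (hle.trans (blockCard_mono h)) k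
            rwa [blockCard_initialVars (hbn _)] at this
          exact hA (h.antisymm (hi ▸ hi₀))
        · rw [if_neg, Nat.cast_zero]
          intro h
          rw [h] at hle
          obtain rfl : i₀ = i := hb _ _ fun k => hle k
          refine hA (eq_of_subset_of_blockCard_le hi₀ ?_).symm
          rw [h, blockCard_initialVars (hbn _)]
  · obtain ⟨p, hp, hps, hpc⟩ := ih₁ (hIJ.trans (le_colonElem J _))
    obtain ⟨q, hq, hqs, hqc⟩ := ih₂ (hIJ.trans le_sup_left)
    have hC : Cpoly (q + X x.1 * p) = Cpoly q + (1 - X x.1) * Cpoly p := by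
      simp [Cpoly]
    refine ⟨q + X x.1 * p, ?_, ?_, fun i => ?_⟩
    · rw [IsKPolynomialOfQuot] at hp hq ⊢
      rw [MvPolynomial.coe_add, MvPolynomial.coe_mul, hp, hq, HSquot_eq_add hJ x,
        MvPolynomial.coe_X]
      ring
    · intro a ha
      rw [hC] at ha
      rcases Finset.mem_union.1 (support_add ha) with ha | ha
      · exact hqs a ha
      · obtain ⟨e, he, hea⟩ := exists_le_of_mem_support_one_sub_X_mul ha
        obtain ⟨i, hi⟩ := hps e he
        exact ⟨i, hi.trans hea⟩
    · obtain ⟨k, hk, hkc⟩ := hpc i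
      obtain ⟨l, hl, hlc⟩ := hqc i
      refine ⟨k + l, ?_, ?_⟩
      · rw [locLength_eq_add _ J (X x), hk, hl, Nat.cast_add]
      · rw [hC, coeff_add, coeff_one_sub_X_mul, hkc, hlc, Nat.cast_add, add_comm]
        intro e he hei
        obtain ⟨j, hj⟩ := hps e he
        obtain rfl : j = i := hb _ _ fun k => (hj.trans hei) k
        exact le_antisymm hei hj

end Multidegree

/-- For a Borel fixed monomial ideal `I` with minimal primes `P_{b_1},…,P_{b_c}`,
the G-multidegree of `S/I` is `Σ_i length((S/I)_{P_{b_i}}) y^{b_i}`, where the length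
(i.e. the Krull dimension of the lattice of submodules) of each localization
`(S/I)_{P_{b_i}}` is the natural number `ℓ i`. -/
theorem stmt7 {K : Type*} [Field K] [Infinite K] {m : ℕ} {n : Fin m → ℕ}
    (I : Ideal (MvPolynomial (MVar m n) K)) (hmon : IsMonomialIdeal I)
    (hBorel : IsBorelFixed I)
    (c : ℕ) (b : Fin c → (Fin m → ℕ)) (hbn : ∀ i k, b i k ≤ n k)
    (hbinj : Function.Injective fun i => (Pb (K := K) (n := n) (b i)))
    (hmin : I.minimalPrimes = Set.range fun i => Pb (K := K) (n := n) (b i))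
    (ℓ : Fin c → ℕ)
    (hℓ : ∀ (i : Fin c) (hpr : (Pb (K := K) (n := n) (b i)).IsPrime),
      letI := hpr
      (ℓ i : WithBot ℕ∞) =
        Order.krullDim (Submodule (Localization.AtPrime (Pb (K := K) (n := n) (b i)))
          (LocalizedModule (Pb (K := K) (n := n) (b i)).primeCompl
            (MvPolynomial (MVar m n) K ⧸ I))))
    (p : MvPolynomial (Fin m) ℤ) (hp : IsKPolynomialOfQuot I p) :
    Gmulti (Cpoly p) =
      ∑ i, monomial (Finsupp.equivFunOnFinite.symm (b i)) ((ℓ i : ℤ)) := by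
  have hb : ∀ i j, b i ≤ b j → i = j := by
    intro i j hij
    have hj : Pb (b j) ∈ I.minimalPrimes := hmin ▸ ⟨j, rfl⟩
    have hi : Pb (b i) ∈ I.minimalPrimes := hmin ▸ ⟨i, rfl⟩
    have hle : Pb (K := K) (n := n) (b i) ≤ Pb (b j) := by
      rw [Pb_eq_span_X, Pb_eq_span_X, span_X_image_le_iff]
      exact initialVars_mono hij
    exact hbinj (le_antisymm hle (hj.2 hi.1 hle))
  have hI : ∀ Q : Ideal (MvPolynomial (MVar m n) K), Q.IsPrime → I ≤ Q →
      ∃ i, Pb (b i) ≤ Q := by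
    intro Q _ hQ
    obtain ⟨P, hP, hPQ⟩ := Ideal.exists_minimalPrimes_le hQ
    rw [hmin] at hP
    obtain ⟨i, rfl⟩ := hP
    exact ⟨i, hPQ⟩
  have hIsupp : HasMonomialSupport I := by
    obtain ⟨T, rfl⟩ := hmon
    exact hasMonomialSupport_span_monomial T
  obtain ⟨q, hq, hqs, hqc⟩ := exists_kPolynomial I b hbn hb hI I hIsupp le_rfl
  obtain rfl : q = p := MvPolynomial.coe_injective _ _ (hq.trans hp.symm)
  have hcoeff : ∀ i, coeff (Finsupp.equivFunOnFinite.symm (b i)) (Cpoly q) = ℓ i := by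
    intro i
    obtain ⟨k, hk, hkc⟩ := hqc i
    have h : ((ℓ i : ℕ∞) : WithBot ℕ∞) = (locLength (Pb (b i)) I : ℕ∞) :=
      (hℓ i inferInstance).trans (Module.coe_length _ _).symm
    rw [WithBot.coe_inj, hk, Nat.cast_inj] at h
    rw [hkc, h]
  have hmem : ∀ i, Finsupp.equivFunOnFinite.symm (b i) ∈ (Cpoly q).support := by
    intro i
    obtain ⟨k, hk, hkc⟩ := hqc i
    have hi : Pb (b i) ∈ I.minimalPrimes := hmin ▸ ⟨i, rfl⟩
    have hpos := locLength_pos hi.1.2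
    rw [hk] at hpos
    rw [mem_support_iff, hkc]
    exact_mod_cast hpos.ne'
  have hminsupp : (Cpoly q).support.filter
      (fun a => ∀ e ∈ (Cpoly q).support, e ≤ a → e = a) =
      Finset.univ.image fun i => Finsupp.equivFunOnFinite.symm (b i) := by
    ext a
    simp only [Finset.mem_filter, Finset.mem_image, Finset.mem_univ, true_and]
    constructor
    · rintro ⟨ha, hamin⟩
      obtain ⟨i, hi⟩ := hqs a ha
      exact ⟨i, hamin _ (hmem i) hi⟩
    · rintro ⟨i, rfl⟩
      refine ⟨hmem i, fun e he hei => ?_⟩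
      obtain ⟨j, hj⟩ := hqs e he
      obtain rfl : j = i := hb _ _ fun k => (hj.trans hei) k
      exact le_antisymm hei hj
  have hinj : Function.Injective fun i =>
      (Finsupp.equivFunOnFinite.symm (b i) : Fin m →₀ ℕ) := fun i j hij =>
    hb i j (Finsupp.equivFunOnFinite.symm.injective hij).le
  rw [Gmulti, hminsupp, Finset.sum_image hinj.injOn]
  simp_rw [hcoeff]
end

section
/- Let I and J be Borel fixed monomial ideals in the multigraded polynomial ring S with the same multigraded Hilbert series. If I is radical, then I = J. -/
open MvPolynomial

/-- The degree-`a` graded piece of an ideal `I`, a `K`-subspace. -/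
noncomputable def gradedPiece {K : Type*} [Field K] {m : ℕ} {n : Fin m → ℕ}
    (I : Ideal (MvPolynomial (MVar m n) K)) (a : Fin m → ℕ) :
    Submodule K (MvPolynomial (MVar m n) K) :=
  I.restrictScalars K ⊓ homogOfDeg K n a

/-- The exponents of the monomials contained in an ideal. -/
def exponents {K σ : Type*} [Field K] (I : Ideal (MvPolynomial σ K)) : Set (σ →₀ ℕ) :=
  {d | monomial d (1 : K) ∈ I}

lemma exponents_isUpperSet {K σ : Type*} [Field K] (I : Ideal (MvPolynomial σ K)) :
    IsUpperSet (exponents I) := by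
  intro d e hde hd
  have h := I.mul_mem_left (monomial (e - d) (1 : K)) hd
  rwa [monomial_mul, tsub_add_cancel_of_le hde, one_mul] at h

section

variable {K : Type*} [Field K] {m : ℕ} {n : Fin m → ℕ} {I : Ideal (MvPolynomial (MVar m n) K)}

lemma IsMonomialIdeal.mem_iff (h : IsMonomialIdeal I) (f : MvPolynomial (MVar m n) K) :
    f ∈ I ↔ ∀ d ∈ f.support, d ∈ exponents I := by
  refine ⟨?_, fun hf => ?_⟩
  · obtain ⟨T, rfl⟩ := h
    intro hf d hd
    obtain ⟨t, ht, htd⟩ := mem_ideal_span_monomial_image.1 hf d hd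
    exact exponents_isUpperSet _ htd (Ideal.subset_span ⟨t, ht, rfl⟩)
  · rw [f.as_sum]
    refine I.sum_mem fun d hd => ?_
    have h1 := I.mul_mem_left (C (coeff d f)) (hf d hd)
    rwa [C_mul_monomial, mul_one] at h1

lemma IsMonomialIdeal.gradedPiece_eq (h : IsMonomialIdeal I) (a : Fin m → ℕ) :
    gradedPiece I a = restrictSupport K (exponents I ∩ {d | mdeg d = a}) := by
  have hom : homogOfDeg K n a = restrictSupport K {d | mdeg d = a} := by
    rw [restrictSupport_eq_span, homogOfDeg]
    congr 1
    ext f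
    simp [eq_comm]
  ext f
  rw [gradedPiece, hom, Submodule.mem_inf, Submodule.restrictScalars_mem, h.mem_iff,
    mem_restrictSupport_iff, mem_restrictSupport_iff, Set.subset_inter_iff]
  rfl

lemma IsMonomialIdeal.finrank_gradedPiece (h : IsMonomialIdeal I) (a : Fin m → ℕ) :
    Module.finrank K (gradedPiece I a) = (exponents I ∩ {d | mdeg d = a}).ncard := by
  rw [h.gradedPiece_eq, Module.finrank_eq_nat_card_basis (basisRestrictSupport K _)]
  rfl

/-- Membership in a monomial ideal is detected after truncating all exponents at a large bound. -/
lemma IsMonomialIdeal.exists_truncation_bound (h : IsMonomialIdeal I) :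
    ∃ k₀ : ℕ, ∀ k ≥ k₀, ∀ d ∈ exponents I,
      d ⊓ Finsupp.equivFunOnFinite.symm (fun _ => k) ∈ exponents I := by
  classical
  obtain ⟨T, hT⟩ := h
  have hfg : (Submodule.span (MvPolynomial (MVar m n) K)
      ((fun d => monomial d (1 : K)) '' T)).FG := IsNoetherian.noetherian _
  rw [Submodule.fg_span_iff_fg_span_finset_subset] at hfg
  obtain ⟨T', hT', hspan⟩ := hfg
  obtain ⟨U, hU, rfl⟩ := Finset.subset_set_image_iff.1 hT'
  have hIU : I = Ideal.span ((fun d => monomial d (1 : K)) '' (U : Set (MVar m n →₀ ℕ))) := by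
    rw [hT, ← Finset.coe_image]
    exact hspan
  refine ⟨∑ u ∈ U, ∑ v, u v, fun k hk d hd => ?_⟩
  have hd' : monomial d (1 : K) ∈ I := hd
  rw [hIU] at hd'
  obtain ⟨t, ht, htd⟩ := mem_ideal_span_monomial_image.1 hd' d (by simp [mem_support_iff])
  refine exponents_isUpperSet I (a := t) (le_inf htd fun v => ?_) ?_
  · calc t v ≤ ∑ v, t v := Finset.single_le_sum (f := fun v => t v) (by simp) (Finset.mem_univ v)
      _ ≤ ∑ u ∈ U, ∑ v, u v :=
        Finset.single_le_sum (f := fun u : MVar m n →₀ ℕ => ∑ v, u v) (by simp) ht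
      _ ≤ k := hk
  · change _ ∈ I
    rw [hIU]
    exact Ideal.subset_span ⟨t, ht, rfl⟩

/-- The exponents of a Borel fixed monomial ideal are stable under lowering the variables
inside each block. -/
lemma IsBorelFixed.mapDomain_mem_exponents [Infinite K] (hI : IsBorelFixed I)
    (hmon : IsMonomialIdeal I) (φ : ∀ i, Fin (n i) → Fin (n i)) (hφ : ∀ i j, φ i j ≤ j)
    {d : MVar m n →₀ ℕ} (hd : d ∈ exponents I) :
    d.mapDomain (fun v : MVar m n => (⟨v.1, φ v.1 v.2⟩ : MVar m n)) ∈ exponents I := by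
  classical
  set ψ : MVar m n → MVar m n := fun v => ⟨v.1, φ v.1 v.2⟩ with hψ
  by_contra hnot
  let P : MvPolynomial (MVar m n) (Polynomial K) :=
    ∏ v, (C Polynomial.X * X v + X (ψ v)) ^ d v
  have hmap (t : K) : map (Polynomial.evalRingHom t) P =
      ∏ v, (C t * X v + X (ψ v)) ^ d v := by
    simp [P]
  let c : Polynomial K := coeff (d.mapDomain ψ) P
  have hc (t : K) : c.eval t =
      coeff (d.mapDomain ψ) (∏ v, (C t * X v + X (ψ v)) ^ d v) := by
    rw [← hmap, coeff_map]
    rfl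
  have hroot (t : K) (h0 : t ≠ 0) (h1 : t ≠ -1) : c.IsRoot t := by
    let g : ∀ i, Matrix (Fin (n i)) (Fin (n i)) K :=
      fun i => Matrix.of fun k j => (if k = j then t else 0) + if k = φ i j then 1 else 0
    have htri (i) : (g i).BlockTriangular id := by
      intro a b hab
      have hab' : b < a := hab
      have h2 : a ≠ φ i b := fun h => absurd (hφ i b) (by rw [← h]; exact not_le.2 hab')
      simp [g, hab'.ne', h2]
    have hdiag (i j) : g i j j ≠ 0 := by
      by_cases hj : j = φ i j
      · simp only [g, Matrix.of_apply, if_true, if_pos hj]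
        exact fun h => h1 (eq_neg_of_add_eq_zero_left h)
      · simp [g, hj, h0]
    have hmem : borelAut g (monomial d 1) ∈ I := by
      have h := Ideal.mem_map_of_mem (borelAut g) (show monomial d (1 : K) ∈ I from hd)
      rwa [hI g htri hdiag] at h
    have himg : borelAut g (monomial d 1) = ∏ v, (C t * X v + X (ψ v)) ^ d v := by
      have hX (v : MVar m n) : ∑ k, C (g v.1 k v.2) * X (⟨v.1, k⟩ : MVar m n)
          = C t * X v + X (ψ v) := by
        simp [g, hψ, add_mul, Finset.sum_add_distrib, apply_ite C, ite_mul]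
      simp only [borelAut, hX, AlgHom.toRingHom_eq_coe, RingHom.coe_coe, aeval_monomial, map_one,
        one_mul, Finsupp.prod_fintype _ _ fun _ => pow_zero _]
    rw [himg, hmon.mem_iff] at hmem
    rw [Polynomial.IsRoot, hc]
    by_contra hne
    exact hnot (hmem _ (mem_support_iff.2 hne))
  have hc0 : c = 0 := by
    refine Polynomial.eq_zero_of_infinite_isRoot c
      ((Set.toFinite ({0, -1} : Set K)).infinite_compl.mono fun t ht => ?_)
    simp only [Set.mem_compl_iff, Set.mem_insert_iff, Set.mem_singleton_iff, not_or] at ht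
    exact hroot t ht.1 ht.2
  have h := hc 0
  have hprod : (∏ v, (X (ψ v) : MvPolynomial (MVar m n) K) ^ d v)
      = monomial (d.mapDomain ψ) 1 := by
    rw [← rename_monomial, monomial_eq, Finsupp.prod_fintype _ _ fun _ => pow_zero _]
    simp
  simp [hc0, hprod] at h

/-- If a Borel fixed monomial ideal contains a monomial in the variables `x_{ij}` with `q i ≤ j`,
it contains a monomial in any set of variables which in each relevant block
has an element of index at most `q i`. -/
lemma IsBorelFixed.exists_mem_exponents [Infinite K] (hI : IsBorelFixed I)
    (hmon : IsMonomialIdeal I) {d : MVar m n →₀ ℕ} (hd : d ∈ exponents I) {q : Fin m → ℕ}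
    (hq : ∀ v, d v ≠ 0 → q v.1 ≤ v.2) {F : Set (MVar m n)}
    (hF : ∀ i, q i < n i → ∃ f : Fin (n i), ⟨i, f⟩ ∈ F ∧ (f : ℕ) ≤ q i) :
    ∃ e ∈ exponents I, ∀ v, e v ≠ 0 → v ∈ F := by
  classical
  have hφ (v : MVar m n) : ∃ w : Fin (n v.1), w ≤ v.2 ∧ (q v.1 ≤ v.2 → ⟨v.1, w⟩ ∈ F) := by
    by_cases hv : q v.1 ≤ v.2
    · obtain ⟨w, hw, hle⟩ := hF v.1 (hv.trans_lt v.2.2)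
      exact ⟨w, hle.trans hv, fun _ => hw⟩
    · exact ⟨v.2, le_rfl, fun h => absurd h hv⟩
  choose φ hφle hφF using hφ
  refine ⟨_, hI.mapDomain_mem_exponents hmon (fun i j => φ ⟨i, j⟩) (fun i j => hφle ⟨i, j⟩) hd,
    fun v hv => ?_⟩
  obtain ⟨w, hw, rfl⟩ := Finset.mem_image.1
    (Finsupp.mapDomain_support (Finsupp.mem_support_iff.2 hv))
  exact hφF w (hq w (Finsupp.mem_support_iff.1 hw))

end

section

variable {σ : Type*}

/-- The generating function of a set of exponents. -/
noncomputable def genFun (D : Set (σ →₀ ℕ)) : MvPowerSeries σ ℤ := D.indicator 1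

open Classical in
lemma coeff_genFun (D : Set (σ →₀ ℕ)) (d : σ →₀ ℕ) :
    MvPowerSeries.coeff d (genFun D) = if d ∈ D then 1 else 0 := by
  rw [MvPowerSeries.coeff_apply, genFun, Set.indicator_apply, Pi.one_apply]

/-- The exponents in the translate by `e` of the cone spanned by the variables in `F`. -/
def orthant (e : σ →₀ ℕ) (F : Finset σ) : Set (σ →₀ ℕ) :=
  {d | e ≤ d ∧ ∀ v ∉ F, d v = e v}

lemma genFun_orthant_mul (e : σ →₀ ℕ) (F : Finset σ) :
    genFun (orthant e F) * ∏ v ∈ F, (1 - MvPowerSeries.X v) = MvPowerSeries.monomial e 1 := by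
  classical
  induction F using Finset.induction_on with
  | empty =>
    ext d
    have : d ∈ orthant e ∅ ↔ d = e := by
      simp only [orthant, Set.mem_ofPred_eq, Finset.notMem_empty, not_false_eq_true, true_imp_iff,
        DFunLike.ext_iff]
      exact ⟨fun h => h.2, fun h => ⟨fun v => (h v).ge, h⟩⟩
    simp [coeff_genFun, MvPowerSeries.coeff_monomial, this]
  | insert v F hv ih =>
    rw [Finset.prod_insert hv, ← mul_assoc, ← ih]
    congr 1
    ext d
    rw [mul_one_sub, map_sub, MvPowerSeries.X_def, MvPowerSeries.coeff_mul_monomial]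
    simp only [coeff_genFun, mul_one]
    have h1 : d ∈ orthant e F ↔ d ∈ orthant e (insert v F) ∧ d v = e v := by
      simp only [orthant, Set.mem_ofPred_eq, Finset.mem_insert]
      grind
    have h2 : (Finsupp.single v 1 ≤ d ∧ d - Finsupp.single v 1 ∈ orthant e (insert v F)) ↔
        d ∈ orthant e (insert v F) ∧ d v ≠ e v := by
      rw [Finsupp.single_le_iff]
      simp only [orthant, Set.mem_ofPred_eq, Finset.mem_insert, Finsupp.le_def,
        Finsupp.tsub_apply, Finsupp.single_apply]
      refine ⟨fun ⟨h, h', h''⟩ => ⟨⟨fun w => ?_, fun w hw => ?_⟩, ?_⟩,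
        fun ⟨⟨h', h''⟩, h⟩ => ⟨?_, fun w => ?_, fun w hw => ?_⟩⟩
      · exact (h' w).trans (Nat.sub_le _ _)
      · have := h'' w hw
        grind
      · have := h' v
        grind
      · have := h' v
        omega
      · have := h' w
        grind
      · have := h'' w hw
        grind
    rw [← ite_and]
    simp only [h1, h2]
    by_cases hd : d ∈ orthant e (insert v F) <;> by_cases hdv : d v = e v <;> simp [hd, hdv]

variable [Fintype σ]

/-- The constant exponent vector. -/
noncomputable def constExp (σ : Type*) [Fintype σ] (k : ℕ) : σ →₀ ℕ :=
  Finsupp.equivFunOnFinite.symm fun _ => k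

open Classical in
/-- The exponents bounded by `k` outside `M`. -/
noncomputable def standardBox (M : Set (σ →₀ ℕ)) (k : ℕ) : Finset (σ →₀ ℕ) :=
  {e ∈ Finset.Iic (constExp σ k) | e ∉ M}

lemma mem_standardBox {M : Set (σ →₀ ℕ)} {k : ℕ} {e : σ →₀ ℕ} :
    e ∈ standardBox M k ↔ e ≤ constExp σ k ∧ e ∉ M := by
  simp [standardBox]

/-- The numerator of the fine Hilbert series of the quotient by a monomial ideal. -/
noncomputable def kNumerator (M : Set (σ →₀ ℕ)) (k : ℕ) : MvPolynomial σ ℤ :=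
  ∑ e ∈ standardBox M k, monomial e 1 * ∏ v with e v < k, (1 - X v)

lemma genFun_compl_eq_sum {M : Set (σ →₀ ℕ)} {k : ℕ}
    (hM : ∀ d, d ∈ M ↔ d ⊓ constExp σ k ∈ M) :
    genFun Mᶜ = ∑ e ∈ standardBox M k, genFun (orthant e {v | e v = k}) := by
  classical
  ext d
  rw [map_sum]
  simp only [coeff_genFun]
  have key : ∀ e ∈ standardBox M k, (d ∈ orthant e {v | e v = k} ↔ d ⊓ constExp σ k = e) := by
    intro e he
    have hek (v) : e v ≤ k := (mem_standardBox.1 he).1 v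
    simp only [orthant, Set.mem_ofPred_eq, DFunLike.ext_iff, Finsupp.inf_apply, Finsupp.le_def,
      constExp, Finsupp.coe_equivFunOnFinite_symm, Finset.mem_filter, Finset.mem_univ, true_and]
    refine ⟨fun h v => ?_, fun h => ⟨fun v => ?_, fun v hv => ?_⟩⟩
    · have := h.1 v
      have := h.2 v
      have := hek v
      grind
    · have := h v
      grind
    · have := h v
      grind
  rw [Finset.sum_congr rfl fun e he => if_congr (key e he) rfl rfl, Finset.sum_ite_eq]
  congr 1
  rw [eq_iff_iff, mem_standardBox, Set.mem_compl_iff, hM]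
  exact ⟨fun h => ⟨inf_le_right, h⟩, fun h => h.2⟩

lemma genFun_compl_mul {M : Set (σ →₀ ℕ)} {k : ℕ} (hM : ∀ d, d ∈ M ↔ d ⊓ constExp σ k ∈ M) :
    genFun Mᶜ * ∏ v, (1 - MvPowerSeries.X v) = (kNumerator M k : MvPowerSeries σ ℤ) := by
  classical
  rw [genFun_compl_eq_sum hM, Finset.sum_mul, kNumerator,
    ← MvPolynomial.coeToMvPowerSeries.ringHom_apply, map_sum]
  refine Finset.sum_congr rfl fun e he => ?_
  have hek (v) : e v ≤ k := (mem_standardBox.1 he).1 v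
  rw [← Finset.prod_filter_mul_prod_filter_not Finset.univ (fun v => e v = k), ← mul_assoc,
    genFun_orthant_mul, map_mul, map_prod]
  simp only [map_sub, map_one, MvPolynomial.coeToMvPowerSeries.ringHom_apply, coe_monomial, coe_X,
    (hek _).lt_iff_ne]

end

section

variable {m : ℕ} {n : Fin m → ℕ}

lemma mapDomain_fst_eq_iff (d : MVar m n →₀ ℕ) (a : Fin m →₀ ℕ) :
    d.mapDomain Sigma.fst = a ↔ mdeg d = a := by
  classical
  have h : ⇑(d.mapDomain Sigma.fst) = mdeg d := by
    ext i
    rw [Finsupp.mapDomain, Finsupp.sum_fintype _ _ (by simp), Finsupp.finsetSum_apply,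
      Fintype.sum_sigma]
    simp [Finsupp.single_apply, mdeg]
  rw [← h, DFunLike.coe_fn_eq]

lemma finite_setOf_mdeg_eq (a : Fin m → ℕ) : {d : MVar m n →₀ ℕ | mdeg d = a}.Finite := by
  refine (Finset.finite_toSet (Finset.Iic (Finsupp.equivFunOnFinite.symm
    fun v : MVar m n => a v.1))).subset fun d hd => ?_
  rw [Finset.mem_coe, Finset.mem_Iic]
  intro v
  rw [← hd]
  exact Finset.single_le_sum (f := fun j => d ⟨v.1, j⟩) (by simp) (Finset.mem_univ v.2)

lemma coeff_rename_genFun (D : Set (MVar m n →₀ ℕ)) (a : Fin m →₀ ℕ) :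
    MvPowerSeries.coeff a (MvPowerSeries.rename Sigma.fst (genFun D)) =
      (D ∩ {d | mdeg d = a}).ncard := by
  classical
  rw [MvPowerSeries.coeff_rename]
  simp only [coeff_genFun, Finset.sum_boole]
  rw [← Set.ncard_coe_finset]
  congr 2
  ext d
  simp [mapDomain_fst_eq_iff, and_comm]

lemma rename_genFun_compl_eq {M N : Set (MVar m n →₀ ℕ)}
    (h : ∀ a : Fin m → ℕ, (M ∩ {d | mdeg d = a}).ncard = (N ∩ {d | mdeg d = a}).ncard) :
    MvPowerSeries.rename Sigma.fst (genFun Mᶜ) = MvPowerSeries.rename Sigma.fst (genFun Nᶜ) := by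
  have hadd (D : Set (MVar m n →₀ ℕ)) : genFun Dᶜ = 1 - genFun D + (genFun Set.univ - 1) := by
    classical
    ext d
    by_cases hd : d ∈ D <;> simp [coeff_genFun, hd]
  have hMN : MvPowerSeries.rename Sigma.fst (genFun M) =
      MvPowerSeries.rename Sigma.fst (genFun N) := by
    ext a
    rw [coeff_rename_genFun, coeff_rename_genFun, h]
  rw [hadd, hadd, map_add, map_add, map_sub, map_sub _ 1 (genFun N), hMN]

/-- The number, in each block, of the exponents smaller than `k`. -/
noncomputable def blockCodim (k : ℕ) (e : MVar m n →₀ ℕ) : Fin m →₀ ℕ :=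
  ∑ v with e v < k, Finsupp.single v.1 1

lemma blockCodim_apply (k : ℕ) (e : MVar m n →₀ ℕ) (i : Fin m) :
    blockCodim k e i = Finset.card {j : Fin (n i) | e ⟨i, j⟩ < k} := by
  classical
  rw [blockCodim, Finset.sum_filter, Finsupp.finsetSum_apply, Fintype.sum_sigma,
    Finset.card_filter, Finset.sum_eq_single i]
  · refine Finset.sum_congr rfl fun j _ => ?_
    split_ifs <;> simp
  · intro l _ hl
    refine Finset.sum_eq_zero fun j _ => ?_
    split_ifs <;> simp [hl]
  · simp

/-- The multigraded numerator after the substitution `y_i = 1 - z_i`. -/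
noncomputable def multidegreeNumerator (M : Set (MVar m n →₀ ℕ)) (k : ℕ) :
    MvPolynomial (Fin m) ℤ :=
  aeval (fun i => 1 - X i) (rename Sigma.fst (kNumerator M k))

lemma multidegreeNumerator_eq_sum (M : Set (MVar m n →₀ ℕ)) (k : ℕ) :
    multidegreeNumerator M k = ∑ e ∈ standardBox M k,
      monomial (blockCodim k e) 1 * ∏ v : MVar m n, (1 - X v.1) ^ e v := by
  rw [multidegreeNumerator, kNumerator, map_sum, map_sum]
  refine Finset.sum_congr rfl fun e _ => ?_
  rw [aeval_rename, map_mul, map_prod, aeval_monomial, mul_comm, blockCodim, monomial_sum_one]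
  simp only [Finsupp.prod_fintype _ _ fun _ => pow_zero _, map_sub, map_one, aeval_X,
    Function.comp_apply, sub_sub_cancel, one_mul]
  rfl

lemma multidegreeNumerator_congr {M N : Set (MVar m n →₀ ℕ)} {k : ℕ}
    (hM : ∀ d, d ∈ M ↔ d ⊓ constExp _ k ∈ M) (hN : ∀ d, d ∈ N ↔ d ⊓ constExp _ k ∈ N)
    (h : ∀ a : Fin m → ℕ, (M ∩ {d | mdeg d = a}).ncard = (N ∩ {d | mdeg d = a}).ncard) :
    multidegreeNumerator M k = multidegreeNumerator N k := by
  rw [multidegreeNumerator, multidegreeNumerator]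
  congr 1
  apply MvPolynomial.coe_injective
  rw [← MvPowerSeries.rename_coe, ← MvPowerSeries.rename_coe, ← genFun_compl_mul hM,
    ← genFun_compl_mul hN, map_mul, map_mul, rename_genFun_compl_eq h]

lemma coeff_multidegreeNumerator_of_minimal {M : Set (MVar m n →₀ ℕ)} {k : ℕ} {q : Fin m →₀ ℕ}
    (hq : ∀ e ∈ standardBox M k, blockCodim k e ≤ q → blockCodim k e = q) :
    coeff q (multidegreeNumerator M k) =
      Finset.card {e ∈ standardBox M k | blockCodim k e = q} := by
  classical
  rw [multidegreeNumerator_eq_sum, coeff_sum, Finset.card_filter, Nat.cast_sum]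
  refine Finset.sum_congr rfl fun e he => ?_
  rw [coeff_monomial_mul']
  by_cases h : blockCodim k e = q
  · simp [h, ← constantCoeff_eq]
  · rw [if_neg fun h' => h (hq e he h'), if_neg h, Nat.cast_zero]

lemma exists_blockCodim_le_of_coeff_ne_zero {M : Set (MVar m n →₀ ℕ)} {k : ℕ} {q : Fin m →₀ ℕ}
    (hq : coeff q (multidegreeNumerator M k) ≠ 0) :
    ∃ e ∈ standardBox M k, blockCodim k e ≤ q := by
  classical
  rw [multidegreeNumerator_eq_sum, coeff_sum] at hq
  obtain ⟨e, he, hne⟩ := Finset.exists_ne_zero_of_sum_ne_zero hq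
  rw [coeff_monomial_mul'] at hne
  exact ⟨e, he, by_contra fun h => hne (if_neg h)⟩

/-- `q` is standard for `M` if no element of `M` is supported on the variables `x_{ij}`
with `q i ≤ j`. -/
def IsStandardTail (M : Set (MVar m n →₀ ℕ)) (q : Fin m →₀ ℕ) : Prop :=
  ∀ d ∈ M, ∃ v, d v ≠ 0 ∧ v.2 < q v.1

lemma IsStandardTail.mono {M : Set (MVar m n →₀ ℕ)} {q q' : Fin m →₀ ℕ} (h : IsStandardTail M q)
    (hqq' : q ≤ q') : IsStandardTail M q' := fun d hd =>
  let ⟨v, hv, hlt⟩ := h d hd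
  ⟨v, hv, hlt.trans_le (hqq' v.1)⟩

lemma IsStandardTail.exists_blockCodim_eq {M : Set (MVar m n →₀ ℕ)} {q : Fin m →₀ ℕ}
    (h : IsStandardTail M q) (hqn : ∀ i, q i ≤ n i) {k : ℕ} (hk : 0 < k) :
    ∃ e ∈ standardBox M k, blockCodim k e = q := by
  classical
  let e : MVar m n →₀ ℕ :=
    Finsupp.equivFunOnFinite.symm fun v => if (v.2 : ℕ) < q v.1 then 0 else k
  have hev (v) : e v = if (v.2 : ℕ) < q v.1 then 0 else k := rfl
  refine ⟨e, ?_, ?_⟩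
  · rw [mem_standardBox]
    refine ⟨fun v => ?_, fun he => ?_⟩
    · rw [hev]
      split_ifs
      · exact Nat.zero_le _
      · exact le_rfl
    · obtain ⟨v, hv, hlt⟩ := h e he
      exact hv (if_pos hlt)
  · ext i
    rw [blockCodim_apply]
    have : (Finset.univ.filter fun j : Fin (n i) => e ⟨i, j⟩ < k) =
        Finset.univ.filter fun j : Fin (n i) => (j : ℕ) < q i := by
      refine Finset.filter_congr fun j _ => ?_
      rw [hev]
      split_ifs with hj <;> simp [hj, hk]
    rw [this, Fin.card_filter_val_lt, min_eq_right (hqn i)]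

/-- The standard tails of `M` are determined by the multigraded Hilbert function. -/
lemma IsStandardTail.of_multidegreeNumerator_eq {M N : Set (MVar m n →₀ ℕ)} {k : ℕ} (hk : 0 < k)
    (hM : ∀ e ∈ standardBox M k, IsStandardTail M (blockCodim k e))
    (hN : ∀ e ∈ standardBox N k, IsStandardTail N (blockCodim k e))
    (hMN : multidegreeNumerator M k = multidegreeNumerator N k) {q : Fin m →₀ ℕ}
    (hq : IsStandardTail M q) (hqn : ∀ i, q i ≤ n i) : IsStandardTail N q := by
  classical
  obtain ⟨p, hpq, hp⟩ := exists_minimal_le_of_wellFoundedLT (IsStandardTail M) q hq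
  refine IsStandardTail.mono ?_ hpq
  have hcoeff := coeff_multidegreeNumerator_of_minimal (M := M) (k := k) (q := p)
    fun e he hle => le_antisymm hle (hp.2 (hM e he) hle)
  obtain ⟨e, he, hep⟩ := hp.1.exists_blockCodim_eq (fun i => (hpq i).trans (hqn i)) hk
  have hne : coeff p (multidegreeNumerator N k) ≠ 0 := by
    rw [← hMN, hcoeff, Nat.cast_ne_zero, Finset.card_ne_zero]
    exact ⟨e, Finset.mem_filter.2 ⟨he, hep⟩⟩
  obtain ⟨e', he', hle⟩ := exists_blockCodim_le_of_coeff_ne_zero hne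
  exact (hN e' he').mono hle

end

lemma IsBorelFixed.isStandardTail_blockCodim {K : Type*} [Field K] [Infinite K] {m : ℕ}
    {n : Fin m → ℕ} {I : Ideal (MvPolynomial (MVar m n) K)} (hI : IsBorelFixed I)
    (hmon : IsMonomialIdeal I) {k : ℕ}
    (hk : ∀ d, d ∈ exponents I ↔ d ⊓ constExp _ k ∈ exponents I)
    {e : MVar m n →₀ ℕ} (he : e ∈ standardBox (exponents I) k) :
    IsStandardTail (exponents I) (blockCodim k e) := by
  classical
  rw [mem_standardBox] at he
  intro d hd
  by_contra! hcon
  have hF : ∀ i, blockCodim k e i < n i →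
      ∃ f : Fin (n i), ⟨i, f⟩ ∈ {v | ¬ e v < k} ∧ (f : ℕ) ≤ blockCodim k e i := by
    intro i hi
    by_contra! hall
    rw [blockCodim_apply] at hi hall
    have hle := Finset.card_le_card (s := Finset.univ.filter fun j : Fin (n i) =>
      (j : ℕ) < Finset.card {j : Fin (n i) | e ⟨i, j⟩ < k} + 1)
      (t := {j : Fin (n i) | e ⟨i, j⟩ < k}) fun j hj => by
        simp only [Finset.mem_filter, Finset.mem_univ, true_and] at hj ⊢
        by_contra hjk
        exact absurd (hall j (not_lt.1 hjk)) (by omega)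
    rw [Fin.card_filter_val_lt] at hle
    omega
  obtain ⟨d', hd', hsupp⟩ := hI.exists_mem_exponents hmon hd hcon hF
  refine he.2 (exponents_isUpperSet I (fun v => ?_) ((hk d').1 hd'))
  have h1 := he.1 v
  have h2 := hsupp v
  simp only [constExp, Finsupp.inf_apply, Finsupp.coe_equivFunOnFinite_symm,
    Set.mem_ofPred_eq] at h1 h2 ⊢
  grind

/-- The least index of a variable of the `i`-th block dividing `x^d`, or `n i` if there is none. -/
noncomputable def minIndex {m : ℕ} {n : Fin m → ℕ} (d : MVar m n →₀ ℕ) : Fin m →₀ ℕ :=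
  Finsupp.equivFunOnFinite.symm fun i =>
    sInf {j : ℕ | j = n i ∨ ∃ l : Fin (n i), (l : ℕ) = j ∧ d ⟨i, l⟩ ≠ 0}

section

variable {m : ℕ} {n : Fin m → ℕ}

lemma minIndex_le (d : MVar m n →₀ ℕ) (i : Fin m) : minIndex d i ≤ n i :=
  Nat.sInf_le (Or.inl rfl)

lemma minIndex_le_of_ne_zero {d : MVar m n →₀ ℕ} {v : MVar m n} (hv : d v ≠ 0) :
    minIndex d v.1 ≤ v.2 :=
  Nat.sInf_le (Or.inr ⟨v.2, rfl, hv⟩)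

lemma exists_eq_minIndex {d : MVar m n →₀ ℕ} {i : Fin m} (h : minIndex d i < n i) :
    ∃ l : Fin (n i), (l : ℕ) = minIndex d i ∧ d ⟨i, l⟩ ≠ 0 :=
  (Nat.sInf_mem (s := {j : ℕ | j = n i ∨ ∃ l : Fin (n i), (l : ℕ) = j ∧ d ⟨i, l⟩ ≠ 0})
    ⟨n i, Or.inl rfl⟩).resolve_left h.ne

lemma IsBorelFixed.isStandardTail_minIndex {K : Type*} [Field K] [Infinite K]
    {I : Ideal (MvPolynomial (MVar m n) K)} (hI : IsBorelFixed I)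
    (hmon : IsMonomialIdeal I) (hrad : I.IsRadical) {d : MVar m n →₀ ℕ} (hd : d ∉ exponents I) :
    IsStandardTail (exponents I) (minIndex d) := by
  intro e he
  by_contra! hcon
  obtain ⟨d', hd', hsupp⟩ := hI.exists_mem_exponents hmon he hcon (F := {v | d v ≠ 0})
    fun i hi => (exists_eq_minIndex hi).imp fun l hl => ⟨hl.2, hl.1.le⟩
  refine hd (hrad ⟨∑ v, d' v, ?_⟩)
  rw [monomial_pow, one_pow]
  refine exponents_isUpperSet I (fun v => ?_) hd'
  by_cases hv : d' v = 0
  · simp [hv]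
  · calc d' v ≤ ∑ v, d' v :=
        Finset.single_le_sum (f := fun v => d' v) (by simp) (Finset.mem_univ v)
      _ ≤ (∑ v, d' v) * d v := Nat.le_mul_of_pos_right _ (Nat.pos_of_ne_zero (hsupp v hv))

end

/-- If `I` and `J` are Borel fixed monomial ideals with the same multigraded
Hilbert series and `I` is radical, then `I = J`. -/
theorem stmt8 {K : Type*} [Field K] [Infinite K] {m : ℕ} {n : Fin m → ℕ}
    (I J : Ideal (MvPolynomial (MVar m n) K))
    (hmonI : IsMonomialIdeal I) (hmonJ : IsMonomialIdeal J)
    (hI : IsBorelFixed I) (hJ : IsBorelFixed J)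
    (hHS : ∀ a : Fin m → ℕ,
      Module.finrank K (gradedPiece I a) = Module.finrank K (gradedPiece J a))
    (hrad : I.IsRadical) : I = J := by
  classical
  obtain ⟨kI, hkI⟩ := hmonI.exists_truncation_bound
  obtain ⟨kJ, hkJ⟩ := hmonJ.exists_truncation_bound
  let k := max (max kI kJ) 1
  have hkI' (d) : d ∈ exponents I ↔ d ⊓ constExp _ k ∈ exponents I :=
    ⟨hkI k (by omega) d, exponents_isUpperSet I inf_le_left⟩
  have hkJ' (d) : d ∈ exponents J ↔ d ⊓ constExp _ k ∈ exponents J :=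
    ⟨hkJ k (by omega) d, exponents_isUpperSet J inf_le_left⟩
  have hcard (a : Fin m → ℕ) : (exponents I ∩ {d | mdeg d = a}).ncard =
      (exponents J ∩ {d | mdeg d = a}).ncard := by
    rw [← hmonI.finrank_gradedPiece, ← hmonJ.finrank_gradedPiece, hHS]
  have hsub : exponents J ⊆ exponents I := by
    intro d hdJ
    by_contra hdI
    have hq := hI.isStandardTail_minIndex hmonI hrad hdI
    obtain ⟨v, hv, hlt⟩ := hq.of_multidegreeNumerator_eq (k := k) (by omega)
      (fun e he => hI.isStandardTail_blockCodim hmonI hkI' he)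
      (fun e he => hJ.isStandardTail_blockCodim hmonJ hkJ' he)
      (multidegreeNumerator_congr hkI' hkJ' hcard) (minIndex_le d) d hdJ
    exact hlt.not_ge (minIndex_le_of_ne_zero hv)
  have heq : exponents J = exponents I := by
    refine hsub.antisymm fun d hd => ?_
    have h := Set.eq_of_subset_of_ncard_le
      (Set.inter_subset_inter_left {e | mdeg e = mdeg d} hsub) (hcard (mdeg d)).le
      ((finite_setOf_mdeg_eq _).inter_of_right _)
    exact (h.ge ⟨hd, rfl⟩).1
  ext f
  rw [hmonI.mem_iff, hmonJ.mem_iff, heq]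
end

section
/- Let K_{m,n}(y) denote the K-polynomial of S/I_m(X) for the ideal of maximal minors of an m×n matrix of indeterminates, with respect to the row-grading deg(x_{ij}) = e_i ∈ Z^m. Then K_{m,n}(y) = 1 − (Π_{i=1}^m y_i) Σ_{k=0}^{n−m} (−1)^k C(n, m+k) h_k(y_1,...,y_m), where h_k is the complete homogeneous symmetric polynomial of degree k. -/
open MvPolynomial

/-- The row multidegree of a monomial exponent `d` on the variables `x_{ij}`,
for the grading `deg x_{ij} = e_i ∈ ℤ^m`. -/
def rowDeg {m n : ℕ} (d : Fin m × Fin n →₀ ℕ) (i : Fin m) : ℕ := ∑ j, d (i, j)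

/-- The `K`-span of the monomials of row multidegree `a`. -/
noncomputable def rowHomog (K : Type*) [Field K] (m n : ℕ) (a : Fin m → ℕ) :
    Submodule K (MvPolynomial (Fin m × Fin n) K) :=
  Submodule.span K {f | ∃ d : Fin m × Fin n →₀ ℕ, rowDeg d = a ∧ f = monomial d (1 : K)}

/-- The degree-`a` graded piece of `S/I` for the row grading. -/
noncomputable def rowQuotPiece {K : Type*} [Field K] {m n : ℕ}
    (I : Ideal (MvPolynomial (Fin m × Fin n) K)) (a : Fin m → ℕ) :
    Submodule K (MvPolynomial (Fin m × Fin n) K ⧸ I) :=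
  Submodule.map (Ideal.Quotient.mkₐ K I).toLinearMap (rowHomog K m n a)

/-- The `ℤ^m`-graded Hilbert series of `S/I` for the row grading. -/
noncomputable def rowHS {K : Type*} [Field K] {m n : ℕ}
    (I : Ideal (MvPolynomial (Fin m × Fin n) K)) : MvPowerSeries (Fin m) ℤ :=
  fun a => (Module.finrank K (rowQuotPiece I (a : Fin m →₀ ℕ) : Submodule K _) : ℤ)

/-- `p` is the `K`-polynomial of `S/I` for the row grading:
`p = ∏_{i=1}^m (1-y_i)^n · HS(S/I, y)`. -/
def IsRowKPolynomial {K : Type*} [Field K] {m n : ℕ}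
    (I : Ideal (MvPolynomial (Fin m × Fin n) K)) (p : MvPolynomial (Fin m) ℤ) : Prop :=
  (p : MvPowerSeries (Fin m) ℤ) = (∏ i, (1 - MvPowerSeries.X i) ^ n) * rowHS I

/-- The complete homogeneous symmetric polynomial `h_k(y_1,…,y_m)`:
the sum of all monomials of total degree `k`. -/
noncomputable def hpoly (m k : ℕ) : MvPolynomial (Fin m) ℤ :=
  ∑ d ∈ Finset.finsuppAntidiag (Finset.univ : Finset (Fin m)) k, monomial d (1 : ℤ)

/-- The maximal minor of the generic `m×n` matrix on columns `c`. -/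
noncomputable def genericMinor (K : Type*) [Field K] (m n : ℕ) (c : Fin m → Fin n) :
    MvPolynomial (Fin m × Fin n) K :=
  Matrix.det (Matrix.of fun i k : Fin m => (X (i, c k) : MvPolynomial (Fin m × Fin n) K))

/-- The ideal `I_m(X)` of maximal minors of the generic `m×n` matrix. -/
noncomputable def maxMinorsIdeal (K : Type*) [Field K] (m n : ℕ) :
    Ideal (MvPolynomial (Fin m × Fin n) K) :=
  Ideal.span {f | ∃ c : Fin m → Fin n, StrictMono c ∧ f = genericMinor K m n c}

/-- The complete homogeneous symmetric function of degree `k` evaluated at a tuple. -/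
def hEval {R : Type*} [CommRing R] {m : ℕ} (y : Fin m → R) (k : ℕ) : R :=
  ((List.Nat.antidiagonalTuple m k).map fun d => ∏ i, y i ^ d i).sum

lemma hpoly_eq_hEval (m k : ℕ) : hpoly m k = hEval X k := by
  have h1 : hEval (R := MvPolynomial (Fin m) ℤ) X k
      = ∑ d ∈ Finset.Nat.antidiagonalTuple m k, ∏ i, X i ^ d i := rfl
  rw [h1, ← Finset.piAntidiag_univ_fin_eq_antidiagonalTuple, hpoly]
  refine Finset.sum_bij' (fun d _ => ⇑d) (fun d _ => Finsupp.equivFunOnFinite.symm d) ?_ ?_ ?_ ?_ ?_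
  · intro d hd
    simpa using hd
  · intro d hd
    simpa using hd
  · intro d _
    ext; simp
  · intro d _
    ext; simp
  · intro d _
    rw [monomial_eq, Finsupp.prod_fintype _ _ (by simp)]
    simp

lemma hEval_zero_right {R : Type*} [CommRing R] {m : ℕ} (y : Fin m → R) : hEval y 0 = 1 := by
  simp [hEval, List.Nat.antidiagonalTuple_zero_right]

lemma hEval_fin_zero_succ {R : Type*} [CommRing R] (y : Fin 0 → R) (k : ℕ) :
    hEval y (k + 1) = 0 := by
  simp [hEval]

lemma hEval_eq_sum_antidiagonal {R : Type*} [CommRing R] {m : ℕ} (y : Fin (m + 1) → R) (k : ℕ) :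
    hEval y k =
      ((List.Nat.antidiagonal k).map fun p => y 0 ^ p.1 * hEval (Fin.tail y) p.2).sum := by
  have : List.Nat.antidiagonalTuple (m + 1) k = (List.Nat.antidiagonal k).flatMap fun ni =>
    (List.Nat.antidiagonalTuple m ni.2).map fun x => Fin.cons ni.1 x := rfl
  rw [hEval, this, List.map_flatMap, List.flatMap_def, List.sum_flatten, List.map_map]
  congr 2
  funext p
  simp [hEval, Function.comp_def, Fin.prod_univ_succ, List.sum_map_mul_left, Fin.tail]

lemma hEval_succ {R : Type*} [CommRing R] {m : ℕ} (y : Fin (m + 1) → R) (k : ℕ) :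
    hEval y (k + 1) = hEval (Fin.tail y) (k + 1) + y 0 * hEval y k := by
  rw [hEval_eq_sum_antidiagonal, List.Nat.antidiagonal_succ, hEval_eq_sum_antidiagonal y k]
  simp [← List.sum_map_mul_left, Function.comp_def, pow_succ', mul_assoc]

/-- The cell `x` lies strictly between the columns chosen by `c` in the previous row and in the
row of `x`. -/
def IsGap {m n : ℕ} (c : Fin m → Fin n) (x : Fin m × Fin n) : Prop :=
  x.2 < c x.1 ∧ ∀ l < x.1, c l < x.2

open Classical in
/-- The sum over increasing `c` of the products of `z i` over the gap cells `(i, j)` of `c`. -/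
noncomputable def gapSum {R : Type*} [CommRing R] {m : ℕ} (n : ℕ) (z : Fin m → R) : R :=
  ∑ c : Fin m → Fin n with StrictMono c, ∏ i, ∏ j, if IsGap c (i, j) then z i else 1

lemma gapSum_fin_zero {R : Type*} [CommRing R] (n : ℕ) (z : Fin 0 → R) : gapSum n z = 1 := by
  have : (Finset.univ.filter fun c : Fin 0 → Fin n => StrictMono c) = Finset.univ :=
    Finset.filter_true_of_mem fun c _ => Subsingleton.strictMono c
  rw [gapSum, this]
  simp

lemma gapSum_zero_succ {R : Type*} [CommRing R] {m : ℕ} (z : Fin (m + 1) → R) :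
    gapSum 0 z = 0 := by
  simp [gapSum]

lemma gapSum_succ_succ {R : Type*} [CommRing R] {m n : ℕ} (z : Fin (m + 1) → R) :
    gapSum (n + 1) z = gapSum n (Fin.tail z) + z 0 * gapSum n z := by
  classical
  unfold gapSum
  rw [← Finset.sum_filter_add_sum_filter_not _ (fun c => c 0 = 0), Finset.mul_sum]
  congr 1
  · symm
    refine Finset.sum_bij (fun c _ => Fin.cons 0 (Fin.succ ∘ c)) ?_ ?_ ?_ ?_
    · intro c hc
      simp only [Finset.mem_filter, Finset.mem_univ, true_and] at hc ⊢
      refine ⟨?_, by simp⟩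
      intro i j hij
      cases j using Fin.cases with
      | zero => exact absurd hij (Fin.not_lt_zero _)
      | succ j =>
        cases i using Fin.cases with
        | zero => simp
        | succ i => simpa using hc (Fin.succ_lt_succ_iff.1 hij)
    · intro c _ c' _ h
      rw [Fin.cons_inj] at h
      exact (Fin.succ_injective n).comp_left h.2
    · intro c hc
      simp only [Finset.mem_filter, Finset.mem_univ, true_and] at hc
      have h0 : ∀ i : Fin m, c i.succ ≠ 0 := fun i =>
        ((Fin.zero_le _).trans_lt (hc.1 (Fin.succ_pos i))).ne'
      refine ⟨fun i => (c i.succ).pred (h0 i), ?_, ?_⟩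
      · simp only [Finset.mem_filter, Finset.mem_univ, true_and]
        intro i j hij
        simpa using hc.1 (Fin.succ_lt_succ_iff.2 hij)
      · funext i
        cases i using Fin.cases <;> simp [hc.2]
    · intro c _
      have h1 : ∀ j, ¬ IsGap (Fin.cons 0 (Fin.succ ∘ c) : Fin (m + 1) → Fin (n + 1)) (0, j) := by
        simp [IsGap]
      have h2 : ∀ i, ¬ IsGap (Fin.cons 0 (Fin.succ ∘ c) : Fin (m + 1) → Fin (n + 1))
          (Fin.succ i, 0) := by
        simp [IsGap, Fin.forall_fin_succ]
      have h3 : ∀ i j, IsGap (Fin.cons 0 (Fin.succ ∘ c) : Fin (m + 1) → Fin (n + 1))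
          (Fin.succ i, Fin.succ j) ↔ IsGap c (i, j) := by
        simp [IsGap, Fin.forall_fin_succ]
      simp [Fin.prod_univ_succ, h1, h2, h3, Fin.tail]
  · symm
    refine Finset.sum_bij (fun c _ => Fin.succ ∘ c) ?_ ?_ ?_ ?_
    · intro c hc
      simp only [Finset.mem_filter, Finset.mem_univ, true_and] at hc ⊢
      exact ⟨Fin.strictMono_succ.comp hc, by simp⟩
    · intro c _ c' _ h
      exact (Fin.succ_injective n).comp_left h
    · intro c hc
      simp only [Finset.mem_filter, Finset.mem_univ, true_and] at hc
      have h0 : ∀ i, c i ≠ 0 := fun i =>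
        ((Fin.pos_iff_ne_zero.2 hc.2).trans_le (hc.1.monotone (Fin.zero_le i))).ne'
      refine ⟨fun i => (c i).pred (h0 i), ?_, ?_⟩
      · simp only [Finset.mem_filter, Finset.mem_univ, true_and]
        intro i j hij
        simpa using hc.1 hij
      · funext i
        simp
    · intro c _
      have h1 : IsGap (Fin.succ ∘ c) (0, 0) := by
        simp [IsGap]
      have h2 : ∀ i, ¬ IsGap (Fin.succ ∘ c) (Fin.succ i, 0) := by
        simp [IsGap, Fin.forall_fin_succ]
      have h3 : ∀ i j, IsGap (Fin.succ ∘ c) (i, Fin.succ j) ↔ IsGap c (i, j) := by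
        simp [IsGap]
      simp [Fin.prod_univ_succ, h1, h2, h3]
      ring

lemma gapSum_one_sub {R : Type*} [CommRing R] (n : ℕ) :
    ∀ {m : ℕ} (y : Fin m → R) (N : ℕ), n ≤ m + N →
      gapSum n (fun i => 1 - y i) =
        ∑ k ∈ Finset.range (N + 1), (-1) ^ k * (n.choose (m + k) : R) * hEval y k := by
  induction n with
  | zero =>
    intro m y N _
    cases m with
    | zero =>
      rw [gapSum_fin_zero, Finset.sum_range_succ']
      simp [hEval_zero_right]
    | succ m => simp [gapSum_zero_succ, Nat.choose_eq_zero_of_lt, Nat.add_right_comm m 1]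
  | succ n ih =>
    intro m y N hN
    cases m with
    | zero =>
      rw [gapSum_fin_zero, Finset.sum_range_succ']
      simp [hEval_zero_right, hEval_fin_zero_succ]
    | succ m =>
      have e : Fin.tail (fun i => 1 - y i) = fun i => 1 - Fin.tail y i := rfl
      rw [gapSum_succ_succ, e, ih (Fin.tail y) N (by omega), ih y N (by omega)]
      have key : ∑ k ∈ Finset.range (N + 1), (-1) ^ k * (n.choose (m + k) : R) * hEval y k
          = ∑ k ∈ Finset.range (N + 1), (-1) ^ k * (n.choose (m + k) : R) * hEval (Fin.tail y) k
            - y 0 * ∑ k ∈ Finset.range (N + 1),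
              (-1) ^ k * (n.choose (m + 1 + k) : R) * hEval y k := by
        rw [Finset.sum_range_succ', Finset.sum_range_succ' (fun k => _ * hEval (Fin.tail y) k),
          Finset.sum_range_succ (fun k => _ * (n.choose (m + 1 + k) : R) * _),
          Nat.choose_eq_zero_of_lt (show n < m + 1 + N by omega)]
        simp only [hEval_succ, hEval_zero_right, mul_add, Finset.sum_add_distrib, Finset.mul_sum]
        have : ∀ k, (-1) ^ (k + 1) * (n.choose (m + (k + 1)) : R) * (y 0 * hEval y k)
            = - (y 0 * ((-1) ^ k * (n.choose (m + 1 + k) : R) * hEval y k)) := by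
          intro k
          rw [show m + (k + 1) = m + 1 + k by ring]
          ring
        simp only [this, Finset.sum_neg_distrib]
        simp
        ring
      have e2 : ∀ k, ((n + 1).choose (m + 1 + k) : R)
          = n.choose (m + k) + n.choose (m + 1 + k) := by
        intro k
        rw [show m + 1 + k = (m + k) + 1 by ring, Nat.choose_succ_succ]
        push_cast
        ring
      simp only [e2, mul_add, add_mul, Finset.sum_add_distrib]
      rw [key]
      ring

lemma rowDeg_add {m n : ℕ} (d e : Fin m × Fin n →₀ ℕ) : rowDeg (d + e) = rowDeg d + rowDeg e := by
  funext i
  simp [rowDeg, Finset.sum_add_distrib]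

lemma rowDeg_single {m n : ℕ} (x : Fin m × Fin n) (k : ℕ) :
    rowDeg (Finsupp.single x k) = Pi.single x.1 k := by
  obtain ⟨i, j⟩ := x
  funext l
  by_cases h : i = l
  · subst h
    simp [rowDeg, Finsupp.single_apply]
  · simp [rowDeg, Ne.symm h]

lemma le_rowDeg {m n : ℕ} (d : Fin m × Fin n →₀ ℕ) (x : Fin m × Fin n) : d x ≤ rowDeg d x.1 :=
  Finset.single_le_sum (f := fun j => d (x.1, j)) (fun _ _ => Nat.zero_le _) (Finset.mem_univ x.2)

lemma finite_setOf_rowDeg_eq {m n : ℕ} (a : Fin m → ℕ) :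
    {d : Fin m × Fin n →₀ ℕ | rowDeg d = a}.Finite := by
  refine (Set.finite_Iic (Finsupp.equivFunOnFinite.symm fun x : Fin m × Fin n => a x.1)).subset ?_
  rintro d rfl x
  exact le_rowDeg d x

/-- The row-graded Hilbert series of the polynomial ring on the cells in `s`. -/
noncomputable def cellSeries {m n : ℕ} (s : Finset (Fin m × Fin n)) : MvPowerSeries (Fin m) ℤ :=
  fun a => ({d : Fin m × Fin n →₀ ℕ | rowDeg d = a ∧ d.support ⊆ s}.ncard : ℤ)

lemma coeff_cellSeries {m n : ℕ} (s : Finset (Fin m × Fin n)) (a : Fin m →₀ ℕ) :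
    MvPowerSeries.coeff a (cellSeries s) =
      ({d : Fin m × Fin n →₀ ℕ | rowDeg d = a ∧ d.support ⊆ s}.ncard : ℤ) :=
  rfl

lemma cellSeries_empty {m n : ℕ} : cellSeries (∅ : Finset (Fin m × Fin n)) = 1 := by
  classical
  ext a
  rw [coeff_cellSeries, MvPowerSeries.coeff_one]
  have h0 : rowDeg (0 : Fin m × Fin n →₀ ℕ) = 0 := by
    funext i
    simp [rowDeg]
  split_ifs with h
  · have : {d : Fin m × Fin n →₀ ℕ | rowDeg d = a ∧ d.support ⊆ ∅} = {0} := by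
      ext d
      simp only [Set.mem_ofPred_eq, Finset.subset_empty, Finsupp.support_eq_empty,
        Set.mem_singleton_iff, and_iff_right_iff_imp]
      rintro rfl
      simp [h0, h]
    rw [this]
    simp
  · have : {d : Fin m × Fin n →₀ ℕ | rowDeg d = a ∧ d.support ⊆ ∅} = ∅ := by
      ext d
      simp only [Set.mem_ofPred_eq, Finset.subset_empty, Finsupp.support_eq_empty,
        Set.mem_empty_iff_false, iff_false, not_and]
      rintro h' rfl
      exact h (DFunLike.coe_injective (by rw [← h', h0]; rfl))
    rw [this]
    simp

lemma one_sub_X_mul_cellSeries_insert {m n : ℕ} {x : Fin m × Fin n} {s : Finset (Fin m × Fin n)}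
    (hx : x ∉ s) : (1 - MvPowerSeries.X x.1) * cellSeries (insert x s) = cellSeries s := by
  classical
  ext a
  rw [sub_mul, one_mul, map_sub, MvPowerSeries.X, MvPowerSeries.coeff_monomial_mul,
    coeff_cellSeries, coeff_cellSeries, coeff_cellSeries]
  have hfin : {d : Fin m × Fin n →₀ ℕ | rowDeg d = a ∧ d.support ⊆ insert x s}.Finite :=
    (finite_setOf_rowDeg_eq a).subset fun d hd => hd.1
  have hdiff : {d : Fin m × Fin n →₀ ℕ | rowDeg d = a ∧ d.support ⊆ insert x s} ∩ {d | d x = 0} =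
      {d | rowDeg d = a ∧ d.support ⊆ s} := by
    ext d
    simp only [Set.mem_inter_iff, Set.mem_ofPred_eq]
    constructor
    · rintro ⟨⟨h1, h2⟩, h3⟩
      refine ⟨h1, (Finset.subset_insert_iff_of_notMem ?_).1 h2⟩
      simpa using h3
    · rintro ⟨h1, h2⟩
      refine ⟨⟨h1, h2.trans (Finset.subset_insert _ _)⟩, ?_⟩
      by_contra h
      exact hx (h2 (Finsupp.mem_support_iff.2 h))
  rw [← Set.ncard_inter_add_ncard_sdiff_eq_ncard _ {d | d x = 0} hfin, hdiff]
  suffices h : (({d : Fin m × Fin n →₀ ℕ | rowDeg d = a ∧ d.support ⊆ insert x s} \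
      {d | d x = 0}).ncard : ℤ) = if Finsupp.single x.1 1 ≤ a then
        1 * ({d : Fin m × Fin n →₀ ℕ | rowDeg d = (a - Finsupp.single x.1 1 : Fin m →₀ ℕ) ∧
          d.support ⊆ insert x s}.ncard : ℤ) else 0 by
    rw [← h]
    push_cast
    ring
  split_ifs with h
  · rw [one_mul, ← Set.ncard_image_of_injective {d : Fin m × Fin n →₀ ℕ |
      rowDeg d = (a - Finsupp.single x.1 1 : Fin m →₀ ℕ) ∧ d.support ⊆ insert x s}
      (add_left_injective (Finsupp.single x 1))]
    congr 2
    ext d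
    simp only [Set.mem_sdiff, Set.mem_ofPred_eq, Set.mem_image]
    constructor
    · rintro ⟨⟨h1, h2⟩, h3⟩
      have hle : Finsupp.single x 1 ≤ d := by
        rw [Finsupp.single_le_iff]
        omega
      refine ⟨d - Finsupp.single x 1, ⟨?_, ?_⟩, tsub_add_cancel_of_le hle⟩
      · have h4 : rowDeg (d - Finsupp.single x 1) + Pi.single x.1 1 = (a : Fin m → ℕ) := by
          rw [← rowDeg_single, ← rowDeg_add, tsub_add_cancel_of_le hle, h1]
        rw [Finsupp.coe_tsub, ← h4, Finsupp.single_eq_pi_single, add_tsub_cancel_right]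
      · exact (Finsupp.support_mono tsub_le_self).trans h2
    · rintro ⟨e, ⟨h1, h2⟩, rfl⟩
      refine ⟨⟨?_, ?_⟩, by simp⟩
      · rw [rowDeg_add, rowDeg_single, h1, ← Finsupp.single_eq_pi_single, ← Finsupp.coe_add,
          tsub_add_cancel_of_le h]
      · refine Finsupp.support_add.trans (Finset.union_subset h2 ?_)
        exact Finsupp.support_single_subset.trans (by simp)
  · norm_cast
    rw [Set.ncard_eq_zero (hfin.subset Set.sdiff_subset), Set.eq_empty_iff_forall_notMem]
    rintro d ⟨⟨h1, -⟩, h2⟩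
    refine h ?_
    rw [Finsupp.single_le_iff, ← h1]
    exact (Nat.one_le_iff_ne_zero.2 h2).trans (le_rowDeg d x)

lemma prod_one_sub_X_mul_cellSeries {m n : ℕ} (s : Finset (Fin m × Fin n)) :
    (∏ x ∈ s, (1 - MvPowerSeries.X x.1)) * cellSeries s = 1 := by
  induction s using Finset.induction_on with
  | empty => rw [Finset.prod_empty, one_mul, cellSeries_empty]
  | insert x s hx ih =>
    rw [Finset.prod_insert hx, mul_comm (1 - _), mul_assoc, one_sub_X_mul_cellSeries_insert hx, ih]

lemma prod_one_sub_X_pow_mul_cellSeries {m n : ℕ} (s : Finset (Fin m × Fin n)) :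
    (∏ i, (1 - MvPowerSeries.X i) ^ n) * cellSeries s = ∏ x ∈ sᶜ, (1 - MvPowerSeries.X x.1) := by
  have h : (∏ i : Fin m, (1 - MvPowerSeries.X i) ^ n : MvPowerSeries (Fin m) ℤ) =
      ∏ x : Fin m × Fin n, (1 - MvPowerSeries.X x.1) := by
    simp [Fintype.prod_prod_type]
  rw [h, ← Finset.prod_compl_mul_prod s, mul_assoc, prod_one_sub_X_mul_cellSeries, mul_one]

/-- The exponent of the term of the minor on columns `c` indexed by the permutation `σ`. -/
noncomputable def permExp {m n : ℕ} (σ : Equiv.Perm (Fin m)) (c : Fin m → Fin n) :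
    Fin m × Fin n →₀ ℕ :=
  ∑ l, Finsupp.single (σ l, c l) 1

lemma genericMinor_eq_sum {K : Type*} [Field K] {m n : ℕ} (c : Fin m → Fin n) :
    genericMinor K m n c =
      ∑ σ : Equiv.Perm (Fin m), (Equiv.Perm.sign σ : ℤ) • monomial (permExp σ c) (1 : K) := by
  rw [genericMinor, Matrix.det_apply']
  refine Finset.sum_congr rfl fun σ _ => ?_
  rw [permExp, monomial_sum_one, zsmul_eq_mul]
  rfl

lemma genericMinor_comp_perm {K : Type*} [Field K] {m n : ℕ} (c : Fin m → Fin n)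
    (σ : Equiv.Perm (Fin m)) :
    genericMinor K m n c = (Equiv.Perm.sign σ : ℤ) • genericMinor K m n (c ∘ σ) := by
  have h : genericMinor K m n (c ∘ σ) = (Equiv.Perm.sign σ : ℤ) * genericMinor K m n c :=
    Matrix.det_permute' σ (Matrix.of fun i k : Fin m => (X (i, c k) : MvPolynomial _ K))
  rw [h, zsmul_eq_mul, ← mul_assoc, ← Int.cast_mul]
  norm_cast
  simp

lemma X_mul_genericMinor {K : Type*} [Field K] {m n : ℕ} (c : Fin m → Fin n) (i : Fin m)
    (j : Fin n) : X (i, j) * genericMinor K m n c =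
      ∑ k, X (i, c k) * genericMinor K m n (Function.update c k j) := by
  have h := congr_fun (Matrix.mulVec_cramer
    (Matrix.of fun i k : Fin m => (X (i, c k) : MvPolynomial (Fin m × Fin n) K))
    (fun i => X (i, j))) i
  have h2 := h.trans (mul_comm _ _)
  refine h2.symm.trans ?_
  rw [Matrix.mulVec_apply_eq_sum]
  refine Finset.sum_congr rfl fun k _ => ?_
  rw [Matrix.cramer_apply, genericMinor, Matrix.of_apply]
  congr 2
  ext a b : 1
  by_cases hb : b = k
  · subst hb
    simp
  · simp [Function.update_of_ne hb, Matrix.updateCol_ne hb]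

lemma exists_perm_strictMono {m n : ℕ} {b : Fin m → Fin n} (hb : Function.Injective b) :
    ∃ σ : Equiv.Perm (Fin m), StrictMono (b ∘ σ) :=
  ⟨Tuple.sort b, (Tuple.monotone_sort b).strictMono_of_injective
    (hb.comp (Tuple.sort b).injective)⟩

/-- The weight of an exponent vector when `x_{ij}` has weight `i * j`. -/
noncomputable def diagWeight {m n : ℕ} : (Fin m × Fin n →₀ ℕ) →+ ℕ :=
  Finsupp.weight fun x => (x.1 * x.2 : ℕ)

lemma diagWeight_single {m n : ℕ} (x : Fin m × Fin n) :
    diagWeight (Finsupp.single x 1) = x.1 * x.2 := by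
  simp [diagWeight, Finsupp.weight_single]

lemma diagWeight_permExp {m n : ℕ} (σ : Equiv.Perm (Fin m)) (c : Fin m → Fin n) :
    diagWeight (permExp σ c) = ∑ l, (σ l * c l : ℕ) := by
  simp [permExp, map_sum, diagWeight_single]

lemma rowDeg_permExp {m n : ℕ} (σ : Equiv.Perm (Fin m)) (c : Fin m → Fin n) :
    rowDeg (permExp σ c) = 1 := by
  have h : ∀ s : Finset (Fin m), rowDeg (∑ l ∈ s, Finsupp.single (σ l, c l) 1) =
      ∑ l ∈ s, Pi.single (σ l) 1 := by
    intro s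
    induction s using Finset.induction_on with
    | empty => funext i; simp [rowDeg]
    | insert l s hl ih =>
      rw [Finset.sum_insert hl, Finset.sum_insert hl, rowDeg_add, ih, rowDeg_single]
  rw [permExp, h, Equiv.sum_comp σ (fun l => (Pi.single l 1 : Fin m → ℕ))]
  exact Finset.univ_sum_single (1 : Fin m → ℕ)

lemma diagWeight_permExp_lt {m n : ℕ} {σ : Equiv.Perm (Fin m)} (hσ : σ ≠ 1) {c : Fin m → Fin n}
    (hc : StrictMono c) : diagWeight (permExp σ c) < diagWeight (permExp 1 c) := by
  rw [diagWeight_permExp, diagWeight_permExp]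
  have hmono : Monovary (fun l : Fin m => (l : ℕ)) (fun l => (c l : ℕ)) := by
    intro a b hab
    exact (hc.lt_iff_lt.1 hab).le
  refine (hmono.sum_comp_perm_mul_lt_sum_mul_iff (σ := σ)).2 fun h => hσ ?_
  have hs : StrictMono σ := by
    intro a b hab
    have : σ a ≤ σ b := h (show (c a : ℕ) < c b from hc hab)
    exact this.lt_of_ne (σ.injective.ne hab.ne)
  ext l
  have := congr_fun (Subsingleton.elim (α := Fin m ≃o Fin m)
    (hs.orderIsoOfSurjective σ σ.surjective) (OrderIso.refl _) ▸ rfl :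
      ⇑(hs.orderIsoOfSurjective σ σ.surjective) = id) l
  simpa using congrArg Fin.val this

lemma IsGap.notMem_range {m n : ℕ} {c : Fin m → Fin n} (hc : StrictMono c) {i : Fin m}
    {j : Fin n} (h : IsGap c (i, j)) (l : Fin m) : c l ≠ j := by
  rcases lt_or_ge l i with hl | hl
  · exact (h.2 l hl).ne
  · exact (h.1.trans_le (hc.monotone hl)).ne'

lemma IsGap.strictMono_update {m n : ℕ} {c : Fin m → Fin n} (hc : StrictMono c) {i : Fin m}
    {j : Fin n} (h : IsGap c (i, j)) : StrictMono (Function.update c i j) := by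
  intro a b hab
  by_cases ha : a = i
  · subst ha
    rw [Function.update_self, Function.update_of_ne hab.ne']
    exact h.1.trans (hc hab)
  · rw [Function.update_of_ne ha]
    by_cases hb : b = i
    · subst hb
      rw [Function.update_self]
      exact h.2 a hab
    · rw [Function.update_of_ne hb]
      exact hc hab

lemma IsGap.update_injective {m n : ℕ} {c : Fin m → Fin n} (hc : StrictMono c) {i : Fin m}
    {j : Fin n} (h : IsGap c (i, j)) (k : Fin m) : Function.Injective (Function.update c k j) := by
  intro a b hab
  by_cases ha : a = k <;> by_cases hb : b = k
  · rw [ha, hb]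
  · subst ha
    rw [Function.update_self, Function.update_of_ne hb] at hab
    exact absurd hab.symm (h.notMem_range hc b)
  · subst hb
    rw [Function.update_self, Function.update_of_ne ha] at hab
    exact absurd hab (h.notMem_range hc a)
  · rw [Function.update_of_ne ha, Function.update_of_ne hb] at hab
    exact hc.injective hab

lemma IsGap.sum_lt {m n : ℕ} {c : Fin m → Fin n} (hc : StrictMono c) {i : Fin m} {j : Fin n}
    (h : IsGap c (i, j)) {k : Fin m} (hk : k ≠ i) (σ : Equiv.Perm (Fin m)) :
    (i * c k : ℕ) + ∑ l : Fin m, (l * Function.update c k j (σ l) : ℕ) <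
      i * j + ∑ l : Fin m, (l * c l : ℕ) := by
  let f : Option (Fin m) → ℕ := fun o => o.elim i fun l => l
  let g : Option (Fin m) → ℕ := fun o => o.elim j fun l => c l
  let τ : Equiv.Perm (Option (Fin m)) := Equiv.swap none (some k) * Equiv.optionCongr σ
  have hτ0 : g (τ none) = c k := by simp [τ, g]
  have hτ : ∀ l, g (τ (some l)) = Function.update c k j (σ l) := by
    intro l
    by_cases hl : σ l = k
    · simp [τ, g, hl]
    · simp [τ, g, hl, Equiv.swap_apply_of_ne_of_ne]
  have hfg : Monovary f g := by
    rintro (_ | a) (_ | b) hab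
    · exact le_rfl
    · by_contra! hlt
      exact (lt_asymm (show j < c b from hab) (h.2 b hlt)).elim
    · by_contra! hlt
      exact (lt_asymm (show c a < j from hab) (h.1.trans (hc hlt))).elim
    · exact (hc.lt_iff_lt.1 hab).le
  have key := (hfg.sum_mul_comp_perm_lt_sum_mul_iff (σ := τ)).2 ?_
  · simpa [Fintype.sum_option, hτ0, hτ, f, g] using key
  · intro hm
    rcases lt_or_gt_of_ne hk with hki | hki
    · have hlt : ∀ l < i, σ l < k := by
        intro l hl
        have h1 : ¬ g (τ none) < g (τ (some l)) := fun hlt =>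
          (show (i : ℕ) ≤ l from @hm none (some l) hlt).not_gt hl
        rw [hτ0, hτ, not_lt, Fin.val_fin_le] at h1
        have h2 : σ l ≠ k := by
          intro e
          rw [e, Function.update_self] at h1
          exact (h.2 k hki).not_ge h1
        rw [Function.update_of_ne h2, hc.le_iff_le] at h1
        exact h1.lt_of_ne h2
      have := Finset.card_le_card_of_injOn (s := Finset.Iio i) (t := Finset.Iio k) σ
        (fun l hl => by simpa using hlt l (by simpa using hl)) σ.injective.injOn
      rw [Fin.card_Iio, Fin.card_Iio] at this
      exact absurd hki (by simpa using this)
    · have hlt : ∀ l, i < l → k < σ l := by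
        intro l hl
        have h1 : ¬ g (τ (some l)) < g (τ none) := fun hlt =>
          (show (l : ℕ) ≤ i from @hm (some l) none hlt).not_gt hl
        rw [hτ0, hτ, not_lt, Fin.val_fin_le] at h1
        have h2 : σ l ≠ k := by
          intro e
          rw [e, Function.update_self] at h1
          exact (h.1.trans (hc hki)).not_ge h1
        rw [Function.update_of_ne h2, hc.le_iff_le] at h1
        exact h1.lt_of_ne h2.symm
      have := Finset.card_le_card_of_injOn (s := Finset.Ioi i) (t := Finset.Ioi k) σ
        (fun l hl => by simpa using hlt l (by simpa using hl)) σ.injective.injOn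
      rw [Fin.card_Ioi, Fin.card_Ioi] at this
      have := Fin.lt_def.1 hki
      omega

/-- The pairs of a column choice and an exponent vector supported away from its gap cells whose
product of minor and monomial has row degree `a`. -/
def stdPairs {m n : ℕ} (a : Fin m → ℕ) : Set ((Fin m → Fin n) × (Fin m × Fin n →₀ ℕ)) :=
  {p | StrictMono p.1 ∧ (∀ x, IsGap p.1 x → p.2 x = 0) ∧ rowDeg (permExp 1 p.1 + p.2) = a}

/-- The product of the minor and the monomial described by a pair. -/
noncomputable def minorProd (K : Type*) [Field K] {m n : ℕ}
    (p : (Fin m → Fin n) × (Fin m × Fin n →₀ ℕ)) : MvPolynomial (Fin m × Fin n) K :=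
  monomial p.2 1 * genericMinor K m n p.1

lemma minorProd_eq_sum {K : Type*} [Field K] {m n : ℕ}
    (p : (Fin m → Fin n) × (Fin m × Fin n →₀ ℕ)) :
    minorProd K p = ∑ σ : Equiv.Perm (Fin m),
      (Equiv.Perm.sign σ : ℤ) • monomial (permExp σ p.1 + p.2) (1 : K) := by
  rw [minorProd, genericMinor_eq_sum, Finset.mul_sum]
  refine Finset.sum_congr rfl fun σ _ => ?_
  rw [mul_smul_comm, monomial_mul, one_mul, add_comm]

lemma minorProd_mem_maxMinorsIdeal {K : Type*} [Field K] {m n : ℕ}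
    {p : (Fin m → Fin n) × (Fin m × Fin n →₀ ℕ)} (hp : StrictMono p.1) :
    minorProd K p ∈ maxMinorsIdeal K m n :=
  Ideal.mul_mem_left _ _ (Ideal.subset_span ⟨p.1, hp, rfl⟩)

lemma minorProd_mem_span {K : Type*} [Field K] {m n : ℕ} (w : ℕ) :
    ∀ s : ℕ, ∀ p : (Fin m → Fin n) × (Fin m × Fin n →₀ ℕ), StrictMono p.1 →
      diagWeight (permExp 1 p.1 + p.2) = w → ∑ l, (p.1 l : ℕ) = s →
      minorProd K p ∈ Submodule.span K (minorProd K '' ⋃ a, stdPairs a) := by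
  induction w using Nat.strong_induction_on with
  | _ w ihw =>
  intro s
  induction s using Nat.strong_induction_on with
  | _ s ihs =>
  rintro ⟨c, e⟩ hc hw hs
  dsimp only at hc hw hs
  by_cases hstd : ∀ x, IsGap c x → e x = 0
  · exact Submodule.subset_span ⟨(c, e), Set.mem_iUnion.2 ⟨_, hc, hstd, rfl⟩, rfl⟩
  push Not at hstd
  obtain ⟨⟨i, j⟩, hg, he⟩ := hstd
  have hle : Finsupp.single (i, j) 1 ≤ e := by
    rw [Finsupp.single_le_iff]
    omega
  obtain ⟨e, rfl⟩ := exists_add_of_le hle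
  have hexp : minorProd K (c, Finsupp.single (i, j) 1 + e) =
      ∑ k, minorProd K (Function.update c k j, Finsupp.single (i, c k) 1 + e) := by
    have hX : ∀ x, (monomial (Finsupp.single x 1 + e) (1 : K)) = monomial e 1 * X x := by
      intro x
      rw [X, monomial_mul, one_mul, add_comm]
    simp only [minorProd, hX, mul_assoc, X_mul_genericMinor c i j, Finset.mul_sum]
  rw [hexp]
  refine Submodule.sum_mem _ fun k _ => ?_
  simp only [map_add, diagWeight_single, diagWeight_permExp, Equiv.Perm.coe_one, id] at hw
  by_cases hk : k = i
  · subst hk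
    have hsum : ∀ f : Fin m → ℕ, ∑ l, f l * (Function.update c k j l : ℕ) + f k * c k =
        f k * j + ∑ l, f l * (c l : ℕ) := by
      intro f
      rw [← Finset.add_sum_erase _ _ (Finset.mem_univ k),
        ← Finset.add_sum_erase _ (fun l => f l * (c l : ℕ)) (Finset.mem_univ k),
        Function.update_self]
      have : ∑ l ∈ Finset.univ.erase k, f l * (Function.update c k j l : ℕ) =
          ∑ l ∈ Finset.univ.erase k, f l * (c l : ℕ) :=
        Finset.sum_congr rfl fun l hl => by rw [Function.update_of_ne (Finset.ne_of_mem_erase hl)]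
      rw [this]
      ring
    refine ihs _ ?_ _ (hg.strictMono_update hc) ?_ rfl
    · have h1 := hsum fun _ => 1
      simp only [one_mul] at h1
      have h2 : (j : ℕ) < c k := hg.1
      dsimp only
      omega
    · have h1 := hsum fun l => l
      simp only [map_add, diagWeight_single, diagWeight_permExp, Equiv.Perm.coe_one, id]
      omega
  · obtain ⟨σ, hσ⟩ := exists_perm_strictMono (hg.update_injective hc k)
    have hperm : minorProd K (Function.update c k j, Finsupp.single (i, c k) 1 + e) =
        (Equiv.Perm.sign σ : ℤ) •
          minorProd K (Function.update c k j ∘ σ, Finsupp.single (i, c k) 1 + e) := by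
      rw [minorProd, minorProd, genericMinor_comp_perm _ σ, mul_smul_comm]
    rw [hperm]
    refine zsmul_mem (ihw _ ?_ _ _ hσ rfl rfl) _
    have h1 := hg.sum_lt hc hk σ
    simp only [map_add, diagWeight_single, diagWeight_permExp, Equiv.Perm.coe_one, id,
      Function.comp_apply]
    omega

lemma maxMinorsIdeal_le_span {K : Type*} [Field K] {m n : ℕ} {f : MvPolynomial (Fin m × Fin n) K}
    (hf : f ∈ maxMinorsIdeal K m n) :
    f ∈ Submodule.span K (minorProd K '' ⋃ a, stdPairs (n := n) a) := by
  suffices h : ∀ g, g * f ∈ Submodule.span K (minorProd K '' ⋃ a, stdPairs (n := n) a) by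
    simpa using h 1
  refine Submodule.span_induction ?_ ?_ ?_ ?_ hf
  · rintro _ ⟨c, hc, rfl⟩ g
    induction g using MvPolynomial.induction_on' with
    | monomial e r =>
      rw [← mul_one r, ← smul_eq_mul (a := r), ← smul_monomial, smul_mul_assoc]
      exact Submodule.smul_mem _ _ (minorProd_mem_span _ _ (c, e) hc rfl rfl)
    | add p q hp hq =>
      rw [add_mul]
      exact add_mem hp hq
  · simp
  · intro x y _ _ hx hy g
    rw [mul_add]
    exact add_mem (hx g) (hy g)
  · intro r x _ hx g
    rw [smul_eq_mul, ← mul_assoc]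
    exact hx _

lemma weight_single_eq_rowDeg {m n : ℕ} (d : Fin m × Fin n →₀ ℕ) :
    Finsupp.weight (fun x : Fin m × Fin n => (Pi.single x.1 1 : Fin m → ℕ)) d = rowDeg d := by
  induction d using Finsupp.induction_linear with
  | zero => funext i; simp [rowDeg]
  | add f g hf hg => rw [map_add, hf, hg, rowDeg_add]
  | single x k =>
    rw [Finsupp.weight_single, rowDeg_single]
    funext l
    by_cases h : l = x.1 <;> simp [h]

lemma rowHomog_eq_weightedHomogeneousSubmodule (K : Type*) [Field K] (m n : ℕ) (a : Fin m → ℕ) :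
    rowHomog K m n a = weightedHomogeneousSubmodule K
      (fun x : Fin m × Fin n => (Pi.single x.1 1 : Fin m → ℕ)) a := by
  apply le_antisymm
  · refine Submodule.span_le.2 ?_
    rintro _ ⟨d, hd, rfl⟩
    exact isWeightedHomogeneous_monomial _ _ _ ((weight_single_eq_rowDeg d).trans hd)
  · intro f hf
    rw [f.as_sum]
    refine Submodule.sum_mem _ fun d hd => ?_
    rw [← mul_one (coeff d f), ← smul_eq_mul, ← smul_monomial]
    refine Submodule.smul_mem _ _ (Submodule.subset_span ⟨d, ?_, rfl⟩)
    rw [← weight_single_eq_rowDeg]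
    exact hf (mem_support_iff.1 hd)

lemma minorProd_isWeightedHomogeneous {K : Type*} [Field K] {m n : ℕ}
    (p : (Fin m → Fin n) × (Fin m × Fin n →₀ ℕ)) :
    IsWeightedHomogeneous (fun x : Fin m × Fin n => (Pi.single x.1 1 : Fin m → ℕ))
      (minorProd K p) (rowDeg (permExp 1 p.1 + p.2)) := by
  rw [minorProd_eq_sum]
  refine IsWeightedHomogeneous.sum _ _ _ fun σ _ => ?_
  rw [← mem_weightedHomogeneousSubmodule]
  refine zsmul_mem ((mem_weightedHomogeneousSubmodule _ _ _ _).2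
    (isWeightedHomogeneous_monomial _ _ _ ?_)) _
  rw [weight_single_eq_rowDeg, rowDeg_add, rowDeg_add, rowDeg_permExp, rowDeg_permExp]

lemma rowHomog_inf_le_span {K : Type*} [Field K] {m n : ℕ} {a : Fin m → ℕ}
    {f : MvPolynomial (Fin m × Fin n) K} (hf : f ∈ rowHomog K m n a)
    (hI : f ∈ maxMinorsIdeal K m n) :
    f ∈ Submodule.span K (minorProd K '' stdPairs (n := n) a) := by
  rw [rowHomog_eq_weightedHomogeneousSubmodule] at hf
  have h := Submodule.mem_map_of_mem (f := weightedHomogeneousComponent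
    (fun x : Fin m × Fin n => (Pi.single x.1 1 : Fin m → ℕ)) a) (maxMinorsIdeal_le_span hI)
  rw [weightedHomogeneousComponent_eq_self hf, Submodule.map_span] at h
  refine (Submodule.span_le.2 ?_ : _ ≤ _) h
  rintro _ ⟨_, ⟨p, hp, rfl⟩, rfl⟩
  obtain ⟨b, hp1, hp2, hp3⟩ := Set.mem_iUnion.1 hp
  by_cases hab : b = a
  · subst hab
    rw [weightedHomogeneousComponent_eq_self (hp3 ▸ minorProd_isWeightedHomogeneous p)]
    exact Submodule.subset_span ⟨p, ⟨hp1, hp2, hp3⟩, rfl⟩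
  · rw [(minorProd_isWeightedHomogeneous p).weightedHomogeneousComponent_ne _ (by
      rw [hp3]; exact Ne.symm hab)]
    exact Submodule.zero_mem _

lemma finite_stdPairs {m n : ℕ} (a : Fin m → ℕ) : (stdPairs (n := n) a).Finite := by
  refine ((Set.finite_univ (α := Fin m → Fin n)).prod
    (Set.finite_Iic (Finsupp.equivFunOnFinite.symm fun x : Fin m × Fin n => a x.1))).subset ?_
  rintro ⟨c, e⟩ ⟨-, -, rfl⟩
  refine ⟨Set.mem_univ _, fun x => (le_rowDeg e x).trans ?_⟩
  rw [Finsupp.equivFunOnFinite_symm_apply_apply, rowDeg_add]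
  exact Nat.le_add_left _ _

lemma stdPairs_injOn {m n : ℕ} (a : Fin m → ℕ) :
    Set.InjOn (fun p : (Fin m → Fin n) × (Fin m × Fin n →₀ ℕ) => permExp 1 p.1 + p.2)
      (stdPairs a) := by
  have key : ∀ (c c' : Fin m → Fin n) (e e' : Fin m × Fin n →₀ ℕ), StrictMono c →
      (∀ x, IsGap c' x → e' x = 0) → permExp 1 c + e = permExp 1 c' + e' →
      ∀ i, (∀ l < i, c l = c' l) → c' i ≤ c i := by
    intro c c' e e' hc hg heq i hi
    by_contra! hlt
    have h1 := DFunLike.congr_fun heq (i, c i)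
    have h2 : e' (i, c i) = 0 := hg _ ⟨hlt, fun l hl => hi l hl ▸ hc hl⟩
    have h3 : permExp 1 c (i, c i) ≠ 0 := by
      simp only [permExp, Finsupp.finsetSum_apply]
      refine (Finset.sum_pos' (fun _ _ => Nat.zero_le _) ⟨i, Finset.mem_univ i, ?_⟩).ne'
      simp
    have h4 : permExp 1 c' (i, c i) = 0 := by
      simp only [permExp, Finsupp.finsetSum_apply]
      refine Finset.sum_eq_zero fun l _ => ?_
      rw [Finsupp.single_eq_of_ne]
      rintro h
      obtain ⟨rfl, h⟩ := Prod.mk.inj h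
      exact hlt.ne h
    rw [Finsupp.add_apply, Finsupp.add_apply, h2, h4] at h1
    omega
  rintro ⟨c, e⟩ ⟨hc, hg, -⟩ ⟨c', e'⟩ ⟨hc', hg', -⟩ heq
  dsimp only at hc hg hc' hg' heq
  have hcc : c = c' := by
    funext i
    induction i using WellFoundedLT.induction with
    | _ i ih =>
    exact le_antisymm (key c' c e' e hc' hg heq.symm i fun l hl => (ih l hl).symm)
      (key c c' e e' hc hg' heq i ih)
  subst hcc
  rw [add_left_cancel heq]

/-- The exponents of row degree `a` that are not divisible by a diagonal term of a minor. -/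
def stdExps {m n : ℕ} (a : Fin m → ℕ) : Set (Fin m × Fin n →₀ ℕ) :=
  {d | rowDeg d = a} \ (fun p => permExp 1 p.1 + p.2) '' stdPairs a

lemma ncard_stdExps {m n : ℕ} (a : Fin m → ℕ) :
    (stdExps (n := n) a).ncard + (stdPairs (n := n) a).ncard =
      {d : Fin m × Fin n →₀ ℕ | rowDeg d = a}.ncard := by
  rw [← (stdPairs_injOn a).ncard_image, stdExps]
  refine Set.ncard_sdiff_add_ncard_of_subset ?_ (finite_setOf_rowDeg_eq a)
  rintro _ ⟨p, hp, rfl⟩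
  exact hp.2.2

lemma mk_monomial_mem_span {K : Type*} [Field K] {m n : ℕ} (a : Fin m → ℕ) (w : ℕ) :
    ∀ d : Fin m × Fin n →₀ ℕ, rowDeg d = a → diagWeight d = w →
      Ideal.Quotient.mkₐ K (maxMinorsIdeal K m n) (monomial d 1) ∈
        Submodule.span K ((fun d => Ideal.Quotient.mkₐ K (maxMinorsIdeal K m n) (monomial d 1)) ''
          stdExps (n := n) a) := by
  induction w using Nat.strong_induction_on with
  | _ w ih =>
  intro d hd hw
  by_cases hstd : d ∈ stdExps a
  · exact Submodule.subset_span ⟨d, hstd, rfl⟩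
  obtain ⟨p, hp, rfl⟩ : d ∈ (fun p => permExp 1 p.1 + p.2) '' stdPairs a := by
    by_contra h
    exact hstd ⟨hd, h⟩
  have h0 : Ideal.Quotient.mkₐ K (maxMinorsIdeal K m n) (minorProd K p) = 0 :=
    Ideal.Quotient.eq_zero_iff_mem.2 (minorProd_mem_maxMinorsIdeal hp.1)
  rw [minorProd_eq_sum, ← Finset.add_sum_erase _ _ (Finset.mem_univ 1), map_add,
    Equiv.Perm.sign_one, Units.val_one, one_smul] at h0
  rw [eq_neg_of_add_eq_zero_left h0, map_sum]
  refine neg_mem (Submodule.sum_mem _ fun σ hσ => ?_)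
  rw [map_zsmul]
  refine zsmul_mem (ih _ ?_ _ ?_ rfl) _
  · rw [← hw, map_add, map_add]
    exact Nat.add_lt_add_right (diagWeight_permExp_lt (Finset.ne_of_mem_erase hσ) hp.1) _
  · rw [← hd, rowDeg_add, rowDeg_add, rowDeg_permExp, rowDeg_permExp]

lemma finrank_span_image_le {K V α : Type*} [Field K] [AddCommGroup V] [Module K V] (f : α → V)
    {s : Set α} (hs : s.Finite) : Module.finrank K (Submodule.span K (f '' s)) ≤ s.ncard := by
  have := (hs.image f).fintype
  refine (finrank_span_le_card (f '' s)).trans ?_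
  rw [← Set.ncard_eq_toFinset_card']
  exact Set.ncard_image_le hs

lemma rowHomog_eq_span_image (K : Type*) [Field K] (m n : ℕ) (a : Fin m → ℕ) :
    rowHomog K m n a = Submodule.span K
      ((fun d => monomial d 1) '' {d : Fin m × Fin n →₀ ℕ | rowDeg d = a}) := by
  rw [rowHomog]
  congr 1
  ext f
  simp [eq_comm]

instance finiteDimensional_rowHomog (K : Type*) [Field K] (m n : ℕ) (a : Fin m → ℕ) :
    FiniteDimensional K (rowHomog K m n a) := by
  rw [rowHomog_eq_span_image]
  exact FiniteDimensional.span_of_finite K ((finite_setOf_rowDeg_eq a).image _)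

lemma finrank_rowHomog (K : Type*) [Field K] (m n : ℕ) (a : Fin m → ℕ) :
    Module.finrank K (rowHomog K m n a) =
      {d : Fin m × Fin n →₀ ℕ | rowDeg d = a}.ncard := by
  have hli : LinearIndependent K (fun d : Fin m × Fin n →₀ ℕ => (monomial d (1 : K))) := by
    simpa using (basisMonomials (Fin m × Fin n) K).linearIndependent
  have := (finite_setOf_rowDeg_eq (n := n) a).fintype
  have h := finrank_span_eq_card (hli.comp
    (Subtype.val : {d : Fin m × Fin n →₀ ℕ | rowDeg d = a} → _) Subtype.val_injective)
  rw [Set.range_comp, Subtype.range_val, ← rowHomog_eq_span_image] at h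
  rw [h, Set.ncard_eq_toFinset_card', Set.toFinset_card]

lemma finrank_rowQuotPiece {K : Type*} [Field K] {m n : ℕ} (a : Fin m → ℕ) :
    Module.finrank K (rowQuotPiece (maxMinorsIdeal K m n) a) + (stdPairs (n := n) a).ncard =
      {d : Fin m × Fin n →₀ ℕ | rowDeg d = a}.ncard := by
  have hle : Module.finrank K (rowQuotPiece (maxMinorsIdeal K m n) a) ≤
      (stdExps (n := n) a).ncard := by
    have hfin : (stdExps (n := n) a).Finite :=
      (finite_setOf_rowDeg_eq a).subset Set.sdiff_subset
    have := FiniteDimensional.span_of_finite K (hfin.image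
      fun d => Ideal.Quotient.mkₐ K (maxMinorsIdeal K m n) (monomial d 1))
    refine (Submodule.finrank_mono ?_).trans (finrank_span_image_le
      (fun d => Ideal.Quotient.mkₐ K (maxMinorsIdeal K m n) (monomial d 1)) hfin)
    rw [rowQuotPiece, rowHomog, Submodule.map_span, Submodule.span_le]
    rintro _ ⟨_, ⟨d, hd, rfl⟩, rfl⟩
    exact mk_monomial_mem_span a _ d hd rfl
  have hker := LinearMap.finrank_range_add_finrank_ker
    ((Ideal.Quotient.mkₐ K (maxMinorsIdeal K m n)).toLinearMap.domRestrict (rowHomog K m n a))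
  rw [LinearMap.range_domRestrict, finrank_rowHomog] at hker
  have hkerle : Module.finrank K (LinearMap.ker
      ((Ideal.Quotient.mkₐ K (maxMinorsIdeal K m n)).toLinearMap.domRestrict
        (rowHomog K m n a))) ≤ (stdPairs (n := n) a).ncard := by
    have := FiniteDimensional.span_of_finite K ((finite_stdPairs (n := n) a).image (minorProd K))
    rw [← Submodule.finrank_map_subtype_eq]
    refine (Submodule.finrank_mono ?_).trans
      (finrank_span_image_le (minorProd K) (finite_stdPairs a))
    rintro _ ⟨⟨f, hf⟩, hfk, rfl⟩
    exact rowHomog_inf_le_span hf (Ideal.Quotient.eq_zero_iff_mem.1 hfk)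
  have hcard := ncard_stdExps (n := n) a
  have hq : Module.finrank K (rowQuotPiece (maxMinorsIdeal K m n) a) =
    Module.finrank K (Submodule.map (Ideal.Quotient.mkₐ K (maxMinorsIdeal K m n)).toLinearMap
      (rowHomog K m n a)) := rfl
  omega

open Classical in
/-- The cells that are not gap cells of `c`. -/
noncomputable def nonGapCells {m n : ℕ} (c : Fin m → Fin n) : Finset (Fin m × Fin n) :=
  {x | ¬ IsGap c x}

lemma ncard_stdPairs_eq_sum {m n : ℕ} (a : Fin m → ℕ) :
    (stdPairs (n := n) a).ncard = ∑ c : Fin m → Fin n with StrictMono c,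
      {e : Fin m × Fin n →₀ ℕ | 1 + rowDeg e = a ∧ e.support ⊆ nonGapCells c}.ncard := by
  classical
  rw [Set.ncard_eq_toFinset_card _ (finite_stdPairs a),
    Finset.card_eq_sum_card_fiberwise (f := Prod.fst)
      (t := Finset.univ.filter fun c : Fin m → Fin n => StrictMono c)
      (fun p hp => by simpa using ((finite_stdPairs a).mem_toFinset.1 hp).1)]
  refine Finset.sum_congr rfl fun c hc => ?_
  have hc' : StrictMono c := (Finset.mem_filter.1 hc).2
  rw [← Set.ncard_coe_finset, ← Set.ncard_image_of_injective
    {e : Fin m × Fin n →₀ ℕ | 1 + rowDeg e = a ∧ e.support ⊆ nonGapCells c}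
    (Prod.mk_right_injective c)]
  congr 1
  ext ⟨c', e⟩
  simp only [Finset.coe_filter, Set.Finite.mem_toFinset, Set.mem_ofPred_eq, Set.mem_image,
    Prod.mk.injEq]
  have hsupp : ∀ c : Fin m → Fin n,
      e.support ⊆ nonGapCells c ↔ ∀ x, IsGap c x → e x = 0 := by
    intro c
    simp only [Finset.subset_iff, nonGapCells, Finset.mem_filter, Finset.mem_univ, true_and,
      Finsupp.mem_support_iff]
    exact forall_congr' fun x => not_imp_not
  constructor
  · rintro ⟨⟨-, h2, h3⟩, rfl⟩
    refine ⟨e, ⟨?_, (hsupp _).2 h2⟩, rfl, rfl⟩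
    rw [← h3, rowDeg_add, rowDeg_permExp]
  · rintro ⟨e, ⟨h1, h2⟩, rfl, rfl⟩
    refine ⟨⟨hc', (hsupp _).1 h2, ?_⟩, rfl⟩
    rw [rowDeg_add, rowDeg_permExp, h1]

lemma coeff_prod_X_mul_cellSeries {m n : ℕ} (s : Finset (Fin m × Fin n)) (a : Fin m →₀ ℕ) :
    MvPowerSeries.coeff a ((∏ i, MvPowerSeries.X i) * cellSeries s) =
      ({e : Fin m × Fin n →₀ ℕ | 1 + rowDeg e = a ∧ e.support ⊆ s}.ncard : ℤ) := by
  classical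
  let u : Fin m →₀ ℕ := ∑ i, Finsupp.single i 1
  have hu : ⇑u = 1 := by
    funext l
    simp [u, Finsupp.finsetSum_apply, Finsupp.single_apply]
  have hX : (∏ i, MvPowerSeries.X i : MvPowerSeries (Fin m) ℤ) = MvPowerSeries.monomial u 1 := by
    have h : monomial u (1 : ℤ) = ∏ i, X i := monomial_sum_one _ _
    rw [← coe_monomial, h, ← coeToMvPowerSeries.ringHom_apply, map_prod]
    simp only [coeToMvPowerSeries.ringHom_apply, coe_X]
  rw [hX, MvPowerSeries.coeff_monomial_mul, coeff_cellSeries]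
  split_ifs with h
  · rw [one_mul]
    congr 3
    ext e
    rw [and_congr_left_iff]
    intro _
    rw [Finsupp.coe_tsub, hu]
    have hle : (1 : Fin m → ℕ) ≤ a := hu ▸ h
    rw [eq_tsub_iff_add_eq_of_le hle, add_comm]
  · have : {e : Fin m × Fin n →₀ ℕ | 1 + rowDeg e = a ∧ e.support ⊆ s} = ∅ := by
      rw [Set.eq_empty_iff_forall_notMem]
      rintro e ⟨h1, -⟩
      refine h fun i => ?_
      rw [hu, ← h1]
      exact Nat.le_add_right _ _
    rw [this]
    simp

lemma rowHS_maxMinorsIdeal (K : Type*) [Field K] (m n : ℕ) :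
    rowHS (maxMinorsIdeal K m n) = cellSeries (Finset.univ : Finset (Fin m × Fin n)) -
      ∑ c : Fin m → Fin n with StrictMono c,
        (∏ i, MvPowerSeries.X i) * cellSeries (nonGapCells c) := by
  ext a
  rw [map_sub, map_sum, eq_sub_iff_add_eq]
  simp only [coeff_prod_X_mul_cellSeries]
  rw [← Nat.cast_sum, ← ncard_stdPairs_eq_sum, coeff_cellSeries]
  have h := finrank_rowQuotPiece (K := K) (n := n) (a : Fin m → ℕ)
  simp only [Finset.subset_univ, and_true]
  rw [← h, Nat.cast_add]
  rfl

lemma prod_one_sub_X_pow_mul_rowHS (K : Type*) [Field K] (m n : ℕ) :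
    (∏ i, (1 - MvPowerSeries.X i) ^ n) * rowHS (maxMinorsIdeal K m n) =
      1 - (∏ i, MvPowerSeries.X i) * gapSum n fun i => 1 - MvPowerSeries.X i := by
  classical
  rw [rowHS_maxMinorsIdeal, mul_sub, prod_one_sub_X_pow_mul_cellSeries, Finset.compl_univ,
    Finset.prod_empty, gapSum, Finset.mul_sum, Finset.mul_sum]
  congr 1
  refine Finset.sum_congr rfl fun c _ => ?_
  rw [mul_left_comm, prod_one_sub_X_pow_mul_cellSeries, ← Fintype.prod_prod_type']
  congr 1
  rw [← Finset.prod_filter]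
  refine Finset.prod_congr ?_ fun _ _ => rfl
  ext x
  simp [nonGapCells]

/-- The `K`-polynomial of `S/I_m(X)` for the row grading is
`1 − (∏_i y_i) Σ_{k=0}^{n−m} (−1)^k C(n, m+k) h_k(y_1,…,y_m)`. -/
theorem stmt14 {K : Type*} [Field K] {m n : ℕ} (hmn : m ≤ n)
    (p : MvPolynomial (Fin m) ℤ) (hp : IsRowKPolynomial (maxMinorsIdeal K m n) p) :
    p = 1 - (∏ i, MvPolynomial.X i) *
      ∑ k ∈ Finset.range (n - m + 1),
        MvPolynomial.C ((-1) ^ k * (n.choose (m + k) : ℤ)) * hpoly m k := by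
  have h1 := gapSum_one_sub n (X : Fin m → MvPolynomial (Fin m) ℤ) (n - m) (by omega)
  have h2 : (∑ k ∈ Finset.range (n - m + 1),
      MvPolynomial.C ((-1) ^ k * (n.choose (m + k) : ℤ)) * hpoly m k) =
      gapSum n fun i => 1 - X i := by
    rw [h1]
    refine Finset.sum_congr rfl fun k _ => ?_
    simp [hpoly_eq_hEval]
  rw [h2]
  apply MvPolynomial.coe_injective
  rw [show (p : MvPowerSeries (Fin m) ℤ) = _ from hp, prod_one_sub_X_pow_mul_rowHS]
  have h3 : ((1 - (∏ i, X i) * gapSum n (fun i => 1 - X i) : MvPolynomial (Fin m) ℤ) :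
      MvPowerSeries (Fin m) ℤ) = coeToMvPowerSeries.ringHom
        (1 - (∏ i, X i) * gapSum n (fun i => 1 - X i)) := rfl
  rw [h3, gapSum, gapSum, map_sub, map_mul, map_prod, map_sum, map_one]
  simp only [map_prod, apply_ite (coeToMvPowerSeries.ringHom), map_sub, map_one,
    coeToMvPowerSeries.ringHom_apply, coe_X]
end
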